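/- arXiv:2206.01844 — 5 statements merged into one kernel-verified Lean document; each statement's English description precedes it below -/
import Mathlib

section
/- For every k ≥ 3 there exist positive constants c_1, c_2 depending only on k and an integer n_0(k) such that for all n ≥ n_0(k): c_1 · n^{k/(k-1)} / (log n)^{1/(k-1)} ≤ ϑ_s(n,k) ≤ c_2 · n^{k/(k-1)} · log n, where ϑ_s(n,k) is the maximum of ϑ(G) over all linear (simple) k-graphs G on n vertices. -/
open Finset

variable {V : Type*} [DecidableEq V]

/-- `I` is an independent set of the hypergraph `G`: no edge of `G` is contained in `I`. -/
def IsIndep (G : Finset (Finset V)) (I : Finset V) : Prop :=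
  ∀ e ∈ G, ¬ e ⊆ I

/-- The degree of a vertex set `S` in the hypergraph `G`: the number of edges containing `S`. -/
def degS (G : Finset (Finset V)) (S : Finset V) : ℕ :=
  (G.filter fun e => S ⊆ e).card

/-- `ϑ(G)`: the minimum `t` such that there are independent sets `I_1, …, I_t` of `G`
covering every edge of the complement of `G` (i.e. every `k`-set which is not an edge). -/
noncomputable def vartheta (k : ℕ) (G : Finset (Finset V)) : ℕ :=
  sInf {t | ∃ I : Fin t → Finset V,
    (∀ j, IsIndep G (I j)) ∧
    ∀ e : Finset V, e.card = k → e ∉ G → ∃ j, e ⊆ I j}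

/-- `G` is a `d`-balanced `k`-graph: `Δ_i(G) ≤ d^{(k-i)/(k-1)}` for all `1 ≤ i ≤ k`. -/
def IsBalanced (k d : ℕ) (G : Finset (Finset V)) : Prop :=
  ∀ i : ℕ, 1 ≤ i → i ≤ k → ∀ S : Finset V, S.card = i →
    (degS G S : ℝ) ≤ (d : ℝ) ^ (((k : ℝ) - i) / ((k : ℝ) - 1))

/-- `G` is a linear (simple) hypergraph: two distinct edges share at most one vertex. -/
def IsLinear (G : Finset (Finset V)) : Prop :=
  ∀ e ∈ G, ∀ f ∈ G, e ≠ f → (e ∩ f).card ≤ 1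

lemma vartheta_le {W : Type*} {k t : ℕ} {G : Finset (Finset W)} (I : Fin t → Finset W)
    (hI : ∀ j, IsIndep G (I j))
    (hcov : ∀ e : Finset W, e.card = k → e ∉ G → ∃ j, e ⊆ I j) : vartheta k G ≤ t :=
  Nat.sInf_le ⟨I, hI, hcov⟩

/-- In a linear hypergraph, a family of edges each containing one of the given pairs is
at most as large as the set of pairs. -/
lemma IsLinear.card_le_of_pairs {G H A : Finset (Finset V)} (hG : IsLinear G) (hH : H ⊆ G)
    (hA : ∀ P ∈ A, P.card = 2) (h : ∀ g ∈ H, ∃ P ∈ A, P ⊆ g) : H.card ≤ A.card := by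
  choose! p hpA hp using h
  refine card_le_card_of_injOn p hpA fun g hg g' hg' hgg => ?_
  by_contra hne
  have h1 := hG g (hH hg) g' (hH hg') hne
  have h2 : p g ⊆ g ∩ g' := subset_inter (hp g hg) (hgg ▸ hp g' hg')
  have h3 := card_le_card h2
  rw [hA _ (hpA g hg)] at h3
  omega

lemma card_filter_eq_const_on [Fintype V] {C : Type*} [Fintype C] [DecidableEq C] (c : C)
    (A : Finset V) :
    (univ.filter fun f : V → C => ∀ v ∈ A, f v = c).card
      = Fintype.card C ^ (Fintype.card V - A.card) := by
  have : (univ.filter fun f : V → C => ∀ v ∈ A, f v = c)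
      = Fintype.piFinset fun v => if v ∈ A then {c} else univ := by
    ext f
    simp only [mem_filter, mem_univ, true_and, Fintype.mem_piFinset]
    refine forall_congr' fun v => ?_
    split_ifs with hv <;> simp [hv]
  rw [this, Fintype.card_piFinset, ← card_compl, ← prod_const, ← prod_subset (subset_univ Aᶜ)]
  · refine prod_congr rfl fun v hv => ?_
    rw [mem_compl] at hv
    simp [hv]
  · intro v _ hv
    rw [mem_compl, not_not] at hv
    simp [hv]

/-- The colour class of `c` under `f`, with the vertices of its monochromatic edges removed. -/
def prunedClass [Fintype V] {C : Type*} [DecidableEq C] (G : Finset (Finset V)) (c : C)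
    (f : V → C) : Finset V :=
  univ.filter fun v => f v = c ∧ ∀ g ∈ G, v ∈ g → ∃ w ∈ g, f w ≠ c

lemma isIndep_prunedClass [Fintype V] {C : Type*} [DecidableEq C] {G : Finset (Finset V)}
    (hG : ∀ e ∈ G, e.Nonempty) (c : C) (f : V → C) : IsIndep G (prunedClass G c f) := by
  intro e he hsub
  obtain ⟨v, hv⟩ := hG e he
  obtain ⟨w, hw, hne⟩ := (mem_filter.1 (hsub hv)).2.2 e he hv
  exact hne (mem_filter.1 (hsub hw)).2.1

lemma card_subset_prunedClass [Fintype V] {C : Type*} [Fintype C] [DecidableEq C] {k : ℕ}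
    (hk : 1 ≤ k) {G : Finset (Finset V)} (hGk : ∀ e ∈ G, e.card = k) (hG : IsLinear G) (c : C)
    (h1 : 4 * (k * Fintype.card V) ≤ Fintype.card C ^ (k - 1))
    (h2 : 4 * k.choose 2 ≤ Fintype.card C) {e : Finset V} (hek : e.card = k) (heG : e ∉ G) :
    Fintype.card C ^ (Fintype.card V - k)
      ≤ 2 * (univ.filter fun f : V → C => e ⊆ prunedClass G c f).card := by
  set q := Fintype.card C with hq
  set n := Fintype.card V with hn
  have hq0 : 0 < q := Fintype.card_pos_iff.2 ⟨c⟩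
  let Z : Finset V → Finset (V → C) := fun A => univ.filter fun f => ∀ v ∈ A, f v = c
  have hZ : ∀ A, (Z A).card = q ^ (n - A.card) := card_filter_eq_const_on c
  let G₁ := G.filter fun g => (g ∩ e).card = 1
  let G₂ := G.filter fun g => 2 ≤ (g ∩ e).card
  let good := univ.filter fun f : V → C => e ⊆ prunedClass G c f
  have hsub : Z e ⊆ good ∪ (G₁.biUnion fun g => Z (e ∪ g)) ∪ G₂.biUnion fun g => Z (e ∪ g) := by
    intro f hf
    have hf' : ∀ v ∈ e, f v = c := (mem_filter.1 hf).2
    by_cases hgood : e ⊆ prunedClass G c f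
    · simp [good, hgood]
    · obtain ⟨v, hve, hv⟩ := not_subset.1 hgood
      simp only [prunedClass, mem_filter, mem_univ, true_and, not_and, not_forall] at hv
      obtain ⟨g, hg, hvg, hgc⟩ := hv (hf' v hve)
      push Not at hgc
      have hfz : f ∈ Z (e ∪ g) := by
        refine mem_filter.2 ⟨mem_univ _, fun w hw => ?_⟩
        rcases mem_union.1 hw with hw | hw
        · exact hf' w hw
        · exact hgc w hw
      have hpos : 0 < (g ∩ e).card := card_pos.2 ⟨v, mem_inter.2 ⟨hvg, hve⟩⟩
      rcases Nat.lt_or_ge 1 (g ∩ e).card with h | h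
      · exact mem_union_right _ (mem_biUnion.2 ⟨g, mem_filter.2 ⟨hg, h⟩, hfz⟩)
      · exact mem_union_left _ (mem_union_right _
          (mem_biUnion.2 ⟨g, mem_filter.2 ⟨hg, by omega⟩, hfz⟩))
  have hcard := (card_le_card hsub).trans
    ((card_union_le _ _).trans (Nat.add_le_add_right (card_union_le _ _) _))
  rw [hZ, hek] at hcard
  have hunion : ∀ g ∈ G, (g ∩ e).card + (e ∪ g).card = 2 * k := by
    intro g hg
    have := card_union_add_card_inter e g
    rw [hek, hGk g hg, inter_comm e g] at this
    omega
  have hle : ∀ A : Finset V, A.card ≤ n := fun A => card_le_univ A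
  have hG₁ : G₁.card ≤ k * n := by
    refine (hG.card_le_of_pairs (filter_subset _ _)
      (A := ((e ×ˢ univ).filter fun x : V × V => x.1 ≠ x.2).image fun x => {x.1, x.2})
      ?_ ?_).trans (card_image_le.trans ((card_filter_le _ _).trans ?_))
    · simp only [mem_image, mem_filter]
      rintro _ ⟨x, ⟨_, hx⟩, rfl⟩
      exact card_pair hx
    · intro g hg
      obtain ⟨hgG, hg1⟩ := mem_filter.1 hg
      obtain ⟨v, hv⟩ := card_pos.1 (by omega : 0 < (g ∩ e).card)
      obtain ⟨hvg, hve⟩ := mem_inter.1 hv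
      have hne : g ≠ e := fun h => heG (h ▸ hgG)
      have hgk := hGk g hgG
      obtain ⟨w, hw, hwv⟩ : ∃ w ∈ g, w ≠ v := by
        by_contra! hcon
        have : g = {v} := eq_singleton_iff_unique_mem.2 ⟨hvg, hcon⟩
        have hk1 : k = 1 := by rw [← hgk, this, card_singleton]
        obtain ⟨a, ha⟩ := card_eq_one.1 (hek.trans hk1)
        rw [ha, mem_singleton] at hve
        exact hne (by rw [this, ha, hve])
      refine ⟨{v, w}, mem_image.2 ⟨(v, w), by simp [hve, hwv.symm], rfl⟩, ?_⟩
      intro x hx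
      rcases mem_insert.1 hx with rfl | hx
      · exact hvg
      · rwa [mem_singleton.1 hx]
    · rw [card_product, hek, card_univ]
  have hG₂ : G₂.card ≤ k.choose 2 := by
    rw [← hek, ← card_powersetCard]
    refine hG.card_le_of_pairs (filter_subset _ _) (fun P hP => (mem_powersetCard.1 hP).2) ?_
    intro g hg
    obtain ⟨P, hP, hP2⟩ := exists_subset_card_eq (mem_filter.1 hg).2
    exact ⟨P, mem_powersetCard.2 ⟨hP.trans inter_subset_right, hP2⟩, hP.trans inter_subset_left⟩
  have hb₁ : 4 * (G₁.biUnion fun g => Z (e ∪ g)).card ≤ q ^ (n - k) := by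
    rcases G₁.eq_empty_or_nonempty with h | ⟨g₀, hg₀⟩
    · simp [h]
    have hkey : ∀ g ∈ G₁, (Z (e ∪ g)).card = q ^ (n - (2 * k - 1)) := by
      intro g hg
      obtain ⟨hgG, hg1⟩ := mem_filter.1 hg
      have := hunion g hgG
      rw [hZ]
      congr 2
      omega
    have hn2 : 2 * k - 1 ≤ n := by
      obtain ⟨hgG, hg1⟩ := mem_filter.1 hg₀
      have := hunion g₀ hgG
      have := hle (e ∪ g₀)
      omega
    have hs : (G₁.biUnion fun g => Z (e ∪ g)).card ≤ k * n * q ^ (n - (2 * k - 1)) := by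
      refine card_biUnion_le.trans ?_
      rw [sum_congr rfl hkey, sum_const, smul_eq_mul]
      exact Nat.mul_le_mul_right _ hG₁
    calc _ ≤ 4 * (k * n * q ^ (n - (2 * k - 1))) := Nat.mul_le_mul_left _ hs
      _ = (4 * (k * n)) * q ^ (n - (2 * k - 1)) := by ring
      _ ≤ q ^ (k - 1) * q ^ (n - (2 * k - 1)) := Nat.mul_le_mul_right _ h1
      _ = q ^ (n - k) := by rw [← pow_add]; congr 1; omega
  have hb₂ : 4 * (G₂.biUnion fun g => Z (e ∪ g)).card ≤ q ^ (n - k) := by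
    rcases G₂.eq_empty_or_nonempty with h | ⟨g₀, hg₀⟩
    · simp [h]
    have hlt : ∀ g ∈ G₂, k + 1 ≤ (e ∪ g).card := by
      intro g hg
      have hgG := (mem_filter.1 hg).1
      by_contra! hlt
      have h1 : e ∪ g = e := (eq_of_subset_of_card_le subset_union_left (by omega)).symm
      have h2 : e ∪ g = g :=
        (eq_of_subset_of_card_le subset_union_right (by rw [hGk g hgG]; omega)).symm
      exact heG (by rwa [← h1, h2])
    have hkey : ∀ g ∈ G₂, (Z (e ∪ g)).card ≤ q ^ (n - (k + 1)) := by
      intro g hg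
      rw [hZ]
      exact Nat.pow_le_pow_right hq0 (by have := hlt g hg; omega)
    have hn2 : k + 1 ≤ n := (hlt g₀ hg₀).trans (hle _)
    have hs : (G₂.biUnion fun g => Z (e ∪ g)).card ≤ k.choose 2 * q ^ (n - (k + 1)) := by
      refine card_biUnion_le.trans ((sum_le_sum hkey).trans ?_)
      rw [sum_const, smul_eq_mul]
      exact Nat.mul_le_mul_right _ hG₂
    calc _ ≤ 4 * (k.choose 2 * q ^ (n - (k + 1))) := Nat.mul_le_mul_left _ hs
      _ = (4 * k.choose 2) * q ^ (n - (k + 1)) := by ring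
      _ ≤ q * q ^ (n - (k + 1)) := Nat.mul_le_mul_right _ h2
      _ = q ^ (n - k) := by rw [← pow_succ']; congr 1; omega
  change _ ≤ 2 * good.card
  omega

/-- If every `x ∈ U` is related to a proportion at least `δ` of `Ω`, then some `t` elements of `Ω`
leave at most a proportion `(1 - δ) ^ t` of `U` uncovered. -/
lemma exists_small_uncovered {Ω X : Type*} [Fintype Ω] [Nonempty Ω] (R : Ω → X → Prop)
    [∀ ω x, Decidable (R ω x)] (U : Finset X) {δ : ℝ} (hδ1 : δ ≤ 1)
    (hδ : ∀ x ∈ U, δ * Fintype.card Ω ≤ (univ.filter fun ω => R ω x).card) (t : ℕ) :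
    ∃ ω : Fin t → Ω, ((U.filter fun x => ∀ j, ¬ R (ω j) x).card : ℝ) ≤ (1 - δ) ^ t * U.card := by
  induction t with
  | zero => exact ⟨Fin.elim0, by simp⟩
  | succ t ih =>
    obtain ⟨ω, hω⟩ := ih
    set U' := U.filter fun x => ∀ j, ¬ R (ω j) x with hU'
    have hsum : ∑ a : Ω, ((U'.filter fun x => ¬ R a x).card : ℝ)
        ≤ ∑ _a : Ω, (1 - δ) * U'.card := by
      have hswap : ∑ a : Ω, (U'.filter fun x => ¬ R a x).card
          = ∑ x ∈ U', (univ.filter fun a : Ω => ¬ R a x).card :=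
        sum_card_bipartiteAbove_eq_sum_card_bipartiteBelow _
      have hx : ∀ x ∈ U', ((univ.filter fun a : Ω => ¬ R a x).card : ℝ)
          ≤ (1 - δ) * Fintype.card Ω := by
        intro x hx
        have h1 := hδ x (mem_filter.1 hx).1
        have h2 : ((univ.filter fun a : Ω => R a x).card : ℝ)
            + (univ.filter fun a : Ω => ¬ R a x).card = Fintype.card Ω := by
          exact_mod_cast card_filter_add_card_filter_not (s := univ) fun a : Ω => R a x
        linarith
      calc _ = ∑ x ∈ U', ((univ.filter fun a : Ω => ¬ R a x).card : ℝ) := by exact_mod_cast hswap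
        _ ≤ ∑ _x ∈ U', (1 - δ) * Fintype.card Ω := sum_le_sum hx
        _ = _ := by simp only [sum_const, nsmul_eq_mul, card_univ]; ring
    obtain ⟨a, _, ha⟩ := exists_le_of_sum_le univ_nonempty hsum
    refine ⟨Fin.cons a ω, ?_⟩
    have hset : (U.filter fun x => ∀ j, ¬ R ((Fin.cons a ω : Fin (t + 1) → Ω) j) x)
        = U'.filter fun x => ¬ R a x := by
      ext x
      simp only [hU', mem_filter, Fin.forall_fin_succ, Fin.cons_zero, Fin.cons_succ]
      tauto
    rw [hset, pow_succ']
    calc _ ≤ (1 - δ) * U'.card := ha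
      _ ≤ (1 - δ) * ((1 - δ) ^ t * U.card) := mul_le_mul_of_nonneg_left hω (by linarith)
      _ = _ := by ring

/-- A quantitative upper bound for `ϑ` of a linear hypergraph, in terms of a number of colours
`q` such that a colour class of a uniformly random `q`-colouring is sparse in edges. -/
lemma IsLinear.vartheta_le_of_colors [Fintype V] {k q t : ℕ} (hk : 1 ≤ k) (hq0 : 0 < q)
    {G : Finset (Finset V)} (hGk : ∀ e ∈ G, e.card = k) (hG : IsLinear G)
    (h1 : 4 * (k * Fintype.card V) ≤ q ^ (k - 1)) (h2 : 4 * k.choose 2 ≤ q)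
    (ht : (1 - 1 / (2 * (q : ℝ) ^ k)) ^ t * (Fintype.card V : ℝ) ^ k < 1) :
    vartheta k G ≤ t := by
  classical
  let c : Fin q := ⟨0, hq0⟩
  have : Nonempty (Fin q) := ⟨c⟩
  let U := (powersetCard k (univ : Finset V)).filter fun e => e ∉ G
  have hqk : (1 : ℝ) ≤ (q : ℝ) ^ k := one_le_pow₀ (by exact_mod_cast hq0)
  have hδ1 : 1 / (2 * (q : ℝ) ^ k) ≤ 1 := by
    rw [div_le_one (by positivity)]
    linarith
  obtain ⟨ω, hω⟩ := exists_small_uncovered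
    (fun (f : V → Fin q) (e : Finset V) => e ⊆ prunedClass G c f) U hδ1 (by
      intro e he
      obtain ⟨he, heG⟩ := mem_filter.1 he
      obtain ⟨_, hek⟩ := mem_powersetCard.1 he
      have := card_subset_prunedClass hk hGk hG c (by simpa using h1) (by simpa using h2) hek heG
      rw [Fintype.card_fin] at this
      have hkn : k ≤ Fintype.card V := hek ▸ card_le_univ e
      have hpow : (q : ℝ) ^ (Fintype.card V) = q ^ k * q ^ (Fintype.card V - k) := by
        rw [← pow_add]
        congr 1
        omega
      rw [Fintype.card_fun, Fintype.card_fin]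
      push_cast
      rw [hpow, div_mul_eq_mul_div, div_le_iff₀ (by positivity)]
      have h' : (q : ℝ) ^ (Fintype.card V - k)
          ≤ 2 * (univ.filter fun f : V → Fin q => e ⊆ prunedClass G c f).card := by
        exact_mod_cast this
      have hm := mul_le_mul_of_nonneg_left h' (by positivity : (0 : ℝ) ≤ (q : ℝ) ^ k)
      linarith) t
  have hU : (U.card : ℝ) ≤ (Fintype.card V : ℝ) ^ k := by
    have : U.card ≤ Fintype.card V ^ k :=
      (card_filter_le _ _).trans (by rw [card_powersetCard, card_univ]; exact Nat.choose_le_pow _ _)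
    exact_mod_cast this
  have hlt : ((U.filter fun e => ∀ j, ¬ e ⊆ prunedClass G c (ω j)).card : ℝ) < 1 :=
    hω.trans_lt ((mul_le_mul_of_nonneg_left hU (pow_nonneg (by linarith) _)).trans_lt ht)
  have hempty : U.filter (fun e => ∀ j, ¬ e ⊆ prunedClass G c (ω j)) = ∅ := by
    rw [← card_eq_zero]
    exact Nat.lt_one_iff.1 (by exact_mod_cast hlt)
  refine vartheta_le (fun j => prunedClass G c (ω j))
    (fun j => isIndep_prunedClass (fun e he => card_pos.1 (by rw [hGk e he]; omega)) _ _)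
    fun e hek heG => ?_
  by_contra! hcon
  have : e ∈ U.filter (fun e => ∀ j, ¬ e ⊆ prunedClass G c (ω j)) :=
    mem_filter.2 ⟨mem_filter.2 ⟨mem_powersetCard.2 ⟨subset_univ _, hek⟩, heG⟩, hcon⟩
  simp [hempty] at this

/-- The `k`-sets sharing at most one vertex with each edge of `G`. -/
def extensions [Fintype V] (k : ℕ) (G : Finset (Finset V)) : Finset (Finset V) :=
  (powersetCard k univ).filter fun e => ∀ f ∈ G, (e ∩ f).card ≤ 1

/-- The number of edges of `G` having at least two vertices in `S`. -/
def pairTouching (G : Finset (Finset V)) (S : Finset V) : ℕ :=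
  (G.filter fun f => 2 ≤ (f ∩ S).card).card

lemma card_filter_superset_le (k : ℕ) {P A : Finset V} (hPA : P ⊆ A) :
    ((powersetCard k A).filter fun e => P ⊆ e).card ≤ (A.card - P.card).choose (k - P.card) := by
  rw [← card_sdiff_of_subset hPA, ← card_powersetCard]
  refine card_le_card_of_injOn (fun e => e \ P) ?_ ?_
  · intro e he
    obtain ⟨he, hP⟩ := mem_filter.1 he
    obtain ⟨heA, hek⟩ := mem_powersetCard.1 he
    exact mem_powersetCard.2 ⟨sdiff_subset_sdiff heA le_rfl, by rw [card_sdiff_of_subset hP, hek]⟩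
  · intro e he e' he' h
    have h1 := (mem_filter.1 he).2
    have h2 := (mem_filter.1 he').2
    rw [← sdiff_union_of_subset h1, ← sdiff_union_of_subset h2]
    exact congrArg (· ∪ P) h

lemma card_filter_two_le_inter_le (k : ℕ) (A f : Finset V) :
    ((powersetCard k A).filter fun e => 2 ≤ (e ∩ f).card).card
      ≤ (f ∩ A).card.choose 2 * (A.card - 2).choose (k - 2) := by
  have hsub : (powersetCard k A).filter (fun e => 2 ≤ (e ∩ f).card)
      ⊆ (powersetCard 2 (f ∩ A)).biUnion fun P => (powersetCard k A).filter fun e => P ⊆ e := by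
    intro e he
    obtain ⟨he, h2⟩ := mem_filter.1 he
    obtain ⟨P, hP, hP2⟩ := exists_subset_card_eq h2
    have hPe := hP.trans inter_subset_left
    have hPA := hPe.trans (mem_powersetCard.1 he).1
    exact mem_biUnion.2 ⟨P, mem_powersetCard.2
      ⟨subset_inter (hP.trans inter_subset_right) hPA, hP2⟩, mem_filter.2 ⟨he, hPe⟩⟩
  refine (card_le_card hsub).trans (card_biUnion_le.trans ?_)
  rw [← card_powersetCard 2 (f ∩ A), ← smul_eq_mul, ← sum_const]
  refine sum_le_sum fun P hP => ?_
  obtain ⟨hP, hP2⟩ := mem_powersetCard.1 hP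
  have := card_filter_superset_le k (hP.trans inter_subset_right)
  rwa [hP2] at this

lemma choose_card_le_extensions [Fintype V] {k : ℕ} {G : Finset (Finset V)}
    (hGk : ∀ e ∈ G, e.card = k) (A : Finset V) :
    A.card.choose k ≤ ((extensions k G).filter fun e => e ⊆ A).card
      + pairTouching G A * (k.choose 2 * (A.card - 2).choose (k - 2)) := by
  have hsub : powersetCard k A ⊆ ((extensions k G).filter fun e => e ⊆ A) ∪
      (G.filter fun f => 2 ≤ (f ∩ A).card).biUnion fun f =>
        (powersetCard k A).filter fun e => 2 ≤ (e ∩ f).card := by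
    intro e he
    obtain ⟨heA, hek⟩ := mem_powersetCard.1 he
    by_cases h : ∀ f ∈ G, (e ∩ f).card ≤ 1
    · exact mem_union_left _ (mem_filter.2 ⟨mem_filter.2
        ⟨mem_powersetCard.2 ⟨subset_univ _, hek⟩, h⟩, heA⟩)
    · push Not at h
      obtain ⟨f, hf, h2⟩ := h
      refine mem_union_right _ (mem_biUnion.2 ⟨f, mem_filter.2 ⟨hf, ?_⟩, mem_filter.2 ⟨he, h2⟩⟩)
      have : (e ∩ f).card ≤ (f ∩ A).card :=
        card_le_card (subset_inter inter_subset_right (inter_subset_left.trans heA))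
      omega
  have := (card_le_card hsub).trans (card_union_le _ _)
  rw [card_powersetCard] at this
  refine this.trans (Nat.add_le_add_left (card_biUnion_le.trans ?_) _)
  rw [pairTouching, ← smul_eq_mul, ← sum_const]
  refine sum_le_sum fun f hf => (card_filter_two_le_inter_le k A f).trans ?_
  refine Nat.mul_le_mul_right _ (Nat.choose_le_choose 2 ?_)
  rw [← hGk f (mem_filter.1 hf).1]
  exact card_le_card inter_subset_left

lemma choose_le_two_mul_card_extensions [Fintype V] {k : ℕ} {G : Finset (Finset V)}
    (hGk : ∀ e ∈ G, e.card = k) (A : Finset V) {D : ℕ} (hD : pairTouching G A ≤ D)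
    (h : 2 * (D * (k.choose 2 * (A.card - 2).choose (k - 2))) ≤ A.card.choose k) :
    A.card.choose k ≤ 2 * ((extensions k G).filter fun e => e ⊆ A).card := by
  have h1 := choose_card_le_extensions hGk A
  have h2 := Nat.mul_le_mul_right (k.choose 2 * (A.card - 2).choose (k - 2)) hD
  omega

lemma choose_univ_le_two_mul_card_extensions [Fintype V] {k : ℕ} {G : Finset (Finset V)}
    (hGk : ∀ e ∈ G, e.card = k) {D : ℕ} (hD : G.card ≤ D)
    (h : 2 * (D * (k.choose 2 * (Fintype.card V - 2).choose (k - 2)))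
      ≤ (Fintype.card V).choose k) :
    (Fintype.card V).choose k ≤ 2 * (extensions k G).card := by
  have := choose_le_two_mul_card_extensions hGk univ ((card_filter_le _ _).trans hD) h
  rwa [filter_true_of_mem fun e _ => subset_univ e] at this

lemma notMem_of_mem_extensions [Fintype V] {k : ℕ} (hk : 2 ≤ k) {G : Finset (Finset V)}
    {e : Finset V} (he : e ∈ extensions k G) : e ∉ G := by
  intro heG
  obtain ⟨hek, h⟩ := mem_filter.1 he
  have := h e heG
  rw [inter_self, (mem_powersetCard.1 hek).2] at this
  omega

lemma IsLinear.insert [Fintype V] {k : ℕ} {G : Finset (Finset V)} (hG : IsLinear G)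
    {e : Finset V} (he : e ∈ extensions k G) : IsLinear (insert e G) := by
  have h := (mem_filter.1 he).2
  intro a ha b hb hab
  rcases mem_insert.1 ha with rfl | ha' <;> rcases mem_insert.1 hb with rfl | hb'
  · exact absurd rfl hab
  · exact h b hb'
  · rw [inter_comm]
    exact h a ha'
  · exact hG a ha' b hb' hab

lemma card_eq_of_mem_insert [Fintype V] {k : ℕ} {G : Finset (Finset V)}
    (hGk : ∀ e ∈ G, e.card = k) {e : Finset V} (he : e ∈ extensions k G) :
    ∀ f ∈ insert e G, f.card = k := by
  intro f hf
  rcases mem_insert.1 hf with rfl | hf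
  · exact (mem_powersetCard.1 (mem_filter.1 he).1).2
  · exact hGk f hf

open Classical in
/-- The contribution of `S` to the potential function driving the greedy construction, when `j`
edges remain to be chosen. -/
noncomputable def potential (D : ℕ) (ρ τ : ℝ) (G : Finset (Finset V)) (j : ℕ) (S : Finset V) : ℝ :=
  (if IsIndep G S ∧ pairTouching G S ≤ D then (1 - ρ) ^ j else 0)
    + Real.exp ((pairTouching G S : ℝ) - D) * (1 + 2 * τ) ^ j

lemma pairTouching_insert_le (G : Finset (Finset V)) (e S : Finset V) :
    pairTouching (insert e G) S ≤ pairTouching G S + if 2 ≤ (e ∩ S).card then 1 else 0 := by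
  rw [pairTouching, filter_insert]
  split_ifs
  · exact card_insert_le _ _
  · rfl

lemma pairTouching_mono {G H : Finset (Finset V)} (h : G ⊆ H) (S : Finset V) :
    pairTouching G S ≤ pairTouching H S :=
  card_le_card (filter_subset_filter _ h)

lemma sum_potential_le [Fintype V] {k D : ℕ} {ρ τ : ℝ} {G : Finset (Finset V)}
    (hGk : ∀ e ∈ G, e.card = k) (S : Finset V) (hρ1 : ρ ≤ 1) (hτ0 : 0 ≤ τ)
    (hext : (Fintype.card V).choose k ≤ 2 * (extensions k G).card)
    (hD : 2 * (D * (k.choose 2 * (S.card - 2).choose (k - 2))) ≤ S.card.choose k)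
    (hρ : 2 * (ρ * (Fintype.card V).choose k) ≤ S.card.choose k) (hρ0 : 0 ≤ ρ)
    (hτ : 2 * ((S.card.choose 2 : ℝ) * (Fintype.card V - 2).choose (k - 2))
      ≤ τ * (Fintype.card V).choose k) (j : ℕ) :
    ∑ e ∈ extensions k G, potential D ρ τ (insert e G) j S
      ≤ (extensions k G).card * potential D ρ τ G (j + 1) S := by
  classical
  set E := extensions k G with hE
  have hEN : (E.card : ℝ) ≤ (Fintype.card V).choose k := by
    have : E.card ≤ (Fintype.card V).choose k :=
      (card_filter_le _ _).trans (by rw [card_powersetCard, card_univ])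
    exact_mod_cast this
  have hNE : ((Fintype.card V).choose k : ℝ) ≤ 2 * E.card := by exact_mod_cast hext
  simp only [potential]
  rw [sum_add_distrib, mul_add]
  refine add_le_add ?_ ?_
  · by_cases h : IsIndep G S ∧ pairTouching G S ≤ D
    · have hle : ∀ e ∈ E, (if IsIndep (insert e G) S ∧ pairTouching (insert e G) S ≤ D
          then (1 - ρ) ^ j else 0) ≤ if ¬ e ⊆ S then (1 - ρ) ^ j else 0 := by
        intro e _
        have h0 : 0 ≤ (1 - ρ) ^ j := pow_nonneg (by linarith) _
        by_cases hi : IsIndep (insert e G) S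
        · rw [if_pos (hi e (mem_insert_self _ _))]
          split_ifs <;> simp [h0]
        · rw [if_neg fun h => hi h.1]
          split_ifs <;> simp [h0]
      refine (sum_le_sum hle).trans ?_
      rw [if_pos h, ← sum_filter, sum_const, nsmul_eq_mul, pow_succ', ← mul_assoc]
      refine mul_le_mul_of_nonneg_right ?_ (pow_nonneg (by linarith) _)
      have h1 := choose_le_two_mul_card_extensions hGk S h.2 hD
      have h1' : (S.card.choose k : ℝ) ≤ 2 * (E.filter fun e => e ⊆ S).card := by exact_mod_cast h1
      have h2 : ((E.filter fun e => e ⊆ S).card : ℝ) + (E.filter fun e => ¬ e ⊆ S).card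
          = E.card := by
        exact_mod_cast card_filter_add_card_filter_not (s := E) fun e => e ⊆ S
      have h3 := mul_le_mul_of_nonneg_left hEN hρ0
      linarith
    · rw [if_neg h, mul_zero]
      refine sum_nonpos fun e _ => ?_
      rw [if_neg fun h' => h ⟨fun f hf => h'.1 f (mem_insert_of_mem hf),
        (pairTouching_mono (subset_insert e G) S).trans h'.2⟩]
  · have hle : ∀ e ∈ E, Real.exp ((pairTouching (insert e G) S : ℝ) - D) * (1 + 2 * τ) ^ j
        ≤ Real.exp ((pairTouching G S : ℝ) - D) * (1 + 2 * τ) ^ j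
          * (1 + 2 * if 2 ≤ (e ∩ S).card then 1 else 0) := by
      intro e _
      have h1 := pairTouching_insert_le G e S
      have hp : 0 ≤ (1 + 2 * τ) ^ j := by positivity
      rw [mul_right_comm]
      refine mul_le_mul_of_nonneg_right ?_ hp
      split_ifs at h1 ⊢ with h2
      · have h1' : (pairTouching (insert e G) S : ℝ) - D ≤ (pairTouching G S - D) + 1 := by
          have : (pairTouching (insert e G) S : ℝ) ≤ pairTouching G S + 1 := by exact_mod_cast h1
          linarith
        refine (Real.exp_le_exp.2 h1').trans ?_
        rw [Real.exp_add]
        refine mul_le_mul_of_nonneg_left ?_ (Real.exp_pos _).le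
        have := Real.exp_one_lt_d9
        linarith
      · rw [mul_zero, add_zero, mul_one]
        exact Real.exp_le_exp.2 (sub_le_sub_right (by exact_mod_cast h1) _)
    refine (sum_le_sum hle).trans ?_
    rw [← mul_sum, show (E.card : ℝ) * (Real.exp ((pairTouching G S : ℝ) - D)
      * (1 + 2 * τ) ^ (j + 1)) = Real.exp ((pairTouching G S : ℝ) - D) * (1 + 2 * τ) ^ j
        * (E.card * (1 + 2 * τ)) by ring]
    refine mul_le_mul_of_nonneg_left ?_ (by positivity)
    rw [sum_add_distrib, ← mul_sum, ← sum_filter]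
    simp only [sum_const, nsmul_eq_mul, mul_one]
    have h1 : ((E.filter fun e => 2 ≤ (e ∩ S).card).card : ℝ)
        ≤ (S.card.choose 2 : ℝ) * (Fintype.card V - 2).choose (k - 2) := by
      have h2 := card_filter_two_le_inter_le k univ S
      rw [inter_univ, card_univ] at h2
      have h3 : (E.filter fun e => 2 ≤ (e ∩ S).card).card ≤ _ :=
        (card_le_card (filter_subset_filter _ (filter_subset _ _))).trans h2
      exact_mod_cast h3
    have h4 := mul_le_mul_of_nonneg_left hNE hτ0
    linarith

/-- A greedy (derandomised) construction of a linear `k`-graph with a prescribed number `M` of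
edges and no independent set of size `s`. -/
lemma exists_isLinear_forall_not_isIndep [Fintype V] {k s D M : ℕ} {ρ τ : ℝ} (hk : 2 ≤ k)
    (hρ0 : 0 ≤ ρ) (hρ1 : ρ ≤ 1) (hτ0 : 0 ≤ τ) (hN : 0 < (Fintype.card V).choose k)
    (hM : 2 * (M * (k.choose 2 * (Fintype.card V - 2).choose (k - 2)))
      ≤ (Fintype.card V).choose k)
    (hD : 2 * (D * (k.choose 2 * (s - 2).choose (k - 2))) ≤ s.choose k)
    (hρ : 2 * (ρ * (Fintype.card V).choose k) ≤ s.choose k)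
    (hτ : 2 * ((s.choose 2 : ℝ) * (Fintype.card V - 2).choose (k - 2))
      ≤ τ * (Fintype.card V).choose k)
    (hΦ : ((Fintype.card V).choose s : ℝ) * ((1 - ρ) ^ M + Real.exp (-D) * (1 + 2 * τ) ^ M) < 1) :
    ∃ G : Finset (Finset V), (∀ e ∈ G, e.card = k) ∧ IsLinear G ∧ G.card = M ∧
      ∀ S : Finset V, S.card = s → ¬ IsIndep G S := by
  classical
  have key : ∀ j ≤ M, ∃ G : Finset (Finset V), (∀ e ∈ G, e.card = k) ∧ IsLinear G ∧ G.card = j ∧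
      ∑ S ∈ powersetCard s univ, potential D ρ τ G (M - j) S < 1 := by
    intro j
    induction j with
    | zero =>
      intro _
      refine ⟨∅, by simp, by simp [IsLinear], rfl, ?_⟩
      have : ∀ S ∈ powersetCard s (univ : Finset V), potential D ρ τ ∅ (M - 0) S
          = (1 - ρ) ^ M + Real.exp (-D) * (1 + 2 * τ) ^ M := by
        intro S _
        simp [potential, pairTouching, IsIndep]
      rw [sum_congr rfl this, sum_const, card_powersetCard, card_univ, nsmul_eq_mul]
      exact hΦ
    | succ j ih =>
      intro hj
      obtain ⟨G, hGk, hG, hGj, hlt⟩ := ih (by omega)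
      have hext := choose_univ_le_two_mul_card_extensions hGk (by omega : G.card ≤ M) hM
      have hne : (extensions k G).Nonempty := card_pos.1 (by omega)
      have hsum : ∑ e ∈ extensions k G,
          ∑ S ∈ powersetCard s univ, potential D ρ τ (insert e G) (M - (j + 1)) S
          ≤ ∑ _e ∈ extensions k G, ∑ S ∈ powersetCard s univ, potential D ρ τ G (M - j) S := by
        rw [sum_comm, sum_const, nsmul_eq_mul, mul_sum]
        refine sum_le_sum fun S hS => ?_
        have hSs := (mem_powersetCard.1 hS).2
        have := sum_potential_le hGk S hρ1 hτ0 hext (hSs ▸ hD) (hSs ▸ hρ) hρ0 (hSs ▸ hτ)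
          (M - (j + 1))
        rwa [show M - (j + 1) + 1 = M - j by omega] at this
      obtain ⟨e, he, hle⟩ := exists_le_of_sum_le hne hsum
      refine ⟨insert e G, card_eq_of_mem_insert hGk he, hG.insert he, ?_, hle.trans_lt hlt⟩
      rw [card_insert_of_notMem (notMem_of_mem_extensions hk he), hGj]
  obtain ⟨G, hGk, hG, hGM, hlt⟩ := key M le_rfl
  refine ⟨G, hGk, hG, hGM, fun S hS hind => ?_⟩
  have hnn : ∀ T ∈ powersetCard s (univ : Finset V), 0 ≤ potential D ρ τ G (M - M) T := by
    intro T _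
    unfold potential
    have : 0 ≤ (1 - ρ) ^ (M - M) := pow_nonneg (by linarith) _
    split_ifs <;> positivity
  have h1 := (single_le_sum hnn (mem_powersetCard.2 ⟨subset_univ S, hS⟩)).trans_lt hlt
  rw [potential, Nat.sub_self, pow_zero, pow_zero, mul_one] at h1
  by_cases hX : pairTouching G S ≤ D
  · rw [if_pos ⟨hind, hX⟩] at h1
    linarith [Real.exp_pos ((pairTouching G S : ℝ) - D)]
  · rw [if_neg fun h => hX h.2, zero_add, Real.exp_lt_one_iff] at h1
    push Not at hX
    have : (D : ℝ) < pairTouching G S := by exact_mod_cast hX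
    linarith

open Classical in
/-- The linear `k`-graphs obtained from `G₀` by adding `j` edges. -/
noncomputable def linearExtensions [Fintype V] (k : ℕ) (G₀ : Finset (Finset V)) (j : ℕ) :
    Finset (Finset (Finset V)) :=
  (powersetCard k univ).powerset.filter fun G => G₀ ⊆ G ∧ IsLinear G ∧ G.card = G₀.card + j

lemma mem_linearExtensions [Fintype V] {k j : ℕ} {G₀ G : Finset (Finset V)} :
    G ∈ linearExtensions k G₀ j ↔
      (∀ e ∈ G, e.card = k) ∧ G₀ ⊆ G ∧ IsLinear G ∧ G.card = G₀.card + j := by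
  simp [linearExtensions, subset_iff, mem_powersetCard]

lemma pow_le_card_linearExtensions [Fintype V] {k M : ℕ} (hk : 2 ≤ k) {G₀ : Finset (Finset V)}
    (hGk : ∀ e ∈ G₀, e.card = k) (hG : IsLinear G₀)
    (hM : 2 * ((G₀.card + M) * (k.choose 2 * (Fintype.card V - 2).choose (k - 2)))
      ≤ (Fintype.card V).choose k) {j : ℕ} (hj : j ≤ M) :
    (Fintype.card V).choose k ^ j ≤ (linearExtensions k G₀ j).card * (2 ^ j * j.factorial) := by
  induction j with
  | zero =>
    have : G₀ ∈ linearExtensions k G₀ 0 := mem_linearExtensions.2 ⟨hGk, Subset.rfl, hG, rfl⟩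
    simpa using card_pos.2 ⟨_, this⟩
  | succ j ih =>
    have ih := ih (by omega)
    set N := (Fintype.card V).choose k
    have hstep : (linearExtensions k G₀ j).card * N
        ≤ 2 * ((linearExtensions k G₀ (j + 1)).card * (j + 1)) := by
      have h1 : (linearExtensions k G₀ j).card * N
          ≤ 2 * ((linearExtensions k G₀ j).sigma fun G => extensions k G).card := by
        rw [card_sigma, mul_sum, ← smul_eq_mul, ← sum_const]
        refine sum_le_sum fun G hG' => ?_
        obtain ⟨h1, -, -, h4⟩ := mem_linearExtensions.1 hG'
        exact choose_univ_le_two_mul_card_extensions h1 (by omega) hM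
      have h2 : ((linearExtensions k G₀ j).sigma fun G => extensions k G).card
          ≤ ((linearExtensions k G₀ (j + 1)).sigma fun G => G \ G₀).card := by
        refine card_le_card_of_injOn (fun x => ⟨insert x.2 x.1, x.2⟩) ?_ ?_
        · rintro ⟨G, e⟩ hx
          obtain ⟨hG', he⟩ := mem_sigma.1 hx
          obtain ⟨h1, h2, h3, h4⟩ := mem_linearExtensions.1 hG'
          have heG := notMem_of_mem_extensions hk he
          refine mem_sigma.2 ⟨mem_linearExtensions.2 ⟨card_eq_of_mem_insert h1 he,
            h2.trans (subset_insert _ _), h3.insert he, ?_⟩,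
            mem_sdiff.2 ⟨mem_insert_self _ _, fun h => heG (h2 h)⟩⟩
          rw [card_insert_of_notMem heG, h4, add_assoc]
        · rintro ⟨G, e⟩ hx ⟨G', e'⟩ hx' h
          simp only [Sigma.mk.injEq, heq_eq_eq] at h ⊢
          obtain ⟨h, rfl⟩ := h
          have heG : e ∉ G := notMem_of_mem_extensions hk (mem_sigma.1 hx).2
          have heG' : e ∉ G' := notMem_of_mem_extensions hk (mem_sigma.1 hx').2
          exact ⟨by rw [← erase_insert heG, h, erase_insert heG'], rfl⟩
      have h3 : ((linearExtensions k G₀ (j + 1)).sigma fun G => G \ G₀).card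
          = (linearExtensions k G₀ (j + 1)).card * (j + 1) := by
        rw [card_sigma, ← smul_eq_mul, ← sum_const]
        refine sum_congr rfl fun G hG' => ?_
        obtain ⟨-, h2, -, h4⟩ := mem_linearExtensions.1 hG'
        rw [card_sdiff_of_subset h2]
        omega
      omega
    calc N ^ (j + 1) = N ^ j * N := pow_succ _ _
      _ ≤ (linearExtensions k G₀ j).card * (2 ^ j * j.factorial) * N := Nat.mul_le_mul_right _ ih
      _ = (linearExtensions k G₀ j).card * N * (2 ^ j * j.factorial) := by ring
      _ ≤ 2 * ((linearExtensions k G₀ (j + 1)).card * (j + 1)) * (2 ^ j * j.factorial) :=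
        Nat.mul_le_mul_right _ hstep
      _ = _ := by rw [Nat.factorial_succ]; ring

lemma exists_cover_of_vartheta_le [Fintype V] {k T : ℕ} (hk : 1 ≤ k) {G : Finset (Finset V)}
    (hGk : ∀ e ∈ G, e.card = k) (hT : vartheta k G ≤ T) :
    ∃ I : Fin T → Finset V, (∀ j, IsIndep G (I j)) ∧
      ∀ e : Finset V, e.card = k → (e ∉ G ↔ ∃ j, e ⊆ I j) := by
  have hne : {t | ∃ I : Fin t → Finset V, (∀ j, IsIndep G (I j)) ∧
      ∀ e : Finset V, e.card = k → e ∉ G → ∃ j, e ⊆ I j}.Nonempty := by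
    let U := (powersetCard k (univ : Finset V)).filter fun e => e ∉ G
    refine ⟨U.card, fun j => (U.equivFin.symm j : Finset V), fun j f hf hsub => ?_,
      fun e hek heG => ?_⟩
    · obtain ⟨h1, h2⟩ := mem_filter.1 (U.equivFin.symm j).2
      have : f = U.equivFin.symm j := eq_of_subset_of_card_le hsub (by rw [hGk f hf, (mem_powersetCard.1 h1).2])
      exact h2 (this ▸ hf)
    · have heU : e ∈ U := mem_filter.2 ⟨mem_powersetCard.2 ⟨subset_univ _, hek⟩, heG⟩
      exact ⟨U.equivFin ⟨e, heU⟩, by simp⟩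
  obtain ⟨I, hI, hcov⟩ := Nat.sInf_mem hne
  change vartheta k G ≤ T at hT
  have hI' : ∀ j : Fin T, IsIndep G (if h : (j : ℕ) < vartheta k G then I ⟨j, h⟩ else ∅) := by
    intro j
    split_ifs with h
    · exact hI _
    · intro f hf hsub
      have := hGk f hf
      rw [subset_empty.1 hsub, card_empty] at this
      omega
  refine ⟨_, hI', fun e hek => ⟨fun heG => ?_, fun ⟨j, hj⟩ heG => hI' j e heG hj⟩⟩
  obtain ⟨j, hj⟩ := hcov e hek heG
  have hj2 : (j : ℕ) < vartheta k G := j.2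
  exact ⟨⟨j, hj2.trans_le hT⟩, by simpa [hj2] using hj⟩

lemma card_filter_card_lt_le {W : Type*} [Fintype W] (hV : 2 ≤ Fintype.card W) (s : ℕ) :
    (univ.filter fun S : Finset W => S.card < s).card ≤ Fintype.card W ^ s := by
  classical
  have hsub : (univ.filter fun S : Finset W => S.card < s)
      ⊆ (range s).biUnion fun i => powersetCard i univ := by
    intro S hS
    exact mem_biUnion.2 ⟨S.card, mem_range.2 (mem_filter.1 hS).2,
      mem_powersetCard.2 ⟨subset_univ _, rfl⟩⟩
  refine (card_le_card hsub).trans (card_biUnion_le.trans ?_)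
  refine (sum_le_sum fun i _ => ?_).trans (Nat.geomSum_lt hV fun i hi => mem_range.1 hi).le
  rw [card_powersetCard, card_univ]
  exact Nat.choose_le_pow _ _

lemma card_le_of_vartheta_le [Fintype V] {k s T : ℕ} (hk : 1 ≤ k) (hV : 2 ≤ Fintype.card V)
    {F : Finset (Finset (Finset V))} (hFk : ∀ G ∈ F, ∀ e ∈ G, e.card = k)
    (hs : ∀ G ∈ F, ∀ S : Finset V, S.card = s → ¬ IsIndep G S)
    (hT : ∀ G ∈ F, vartheta k G ≤ T) : F.card ≤ Fintype.card V ^ (s * T) := by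
  have hex := fun G hG => exists_cover_of_vartheta_le hk (hFk G hG) (hT G hG)
  choose! I hI hcov using hex
  have hle : F.card ≤ (Fintype.piFinset fun _ : Fin T =>
      univ.filter fun S : Finset V => S.card < s).card := by
    refine card_le_card_of_injOn I (fun G hG => Fintype.mem_piFinset.2 fun j =>
      mem_filter.2 ⟨mem_univ _, ?_⟩) fun G hG G' hG' h => ?_
    · by_contra! hcon
      obtain ⟨S, hS, hSs⟩ := exists_subset_card_eq hcon
      exact hs G hG S hSs fun e he hsub => hI G hG j e he (hsub.trans hS)
    · ext e
      refine ⟨fun he => ?_, fun he => ?_⟩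
      · have := hcov G hG e (hFk G hG e he)
        rw [h, ← hcov G' hG' e (hFk G hG e he)] at this
        tauto
      · have := hcov G' hG' e (hFk G' hG' e he)
        rw [← h, ← hcov G hG e (hFk G' hG' e he)] at this
        tauto
  refine hle.trans ?_
  rw [Fintype.card_piFinset, prod_const, card_univ, Fintype.card_fin, pow_mul]
  exact Nat.pow_le_pow_left (card_filter_card_lt_le hV s) T

/-- A counting lower bound for `ϑ`: some linear extension of a linear `k`-graph `G₀` without
independent sets of size `s` has large `ϑ`. -/
lemma exists_isLinear_choose_pow_le [Fintype V] {k s M : ℕ} (hk : 2 ≤ k)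
    (hV : 2 ≤ Fintype.card V) {G₀ : Finset (Finset V)}
    (hGk : ∀ e ∈ G₀, e.card = k) (hG : IsLinear G₀)
    (hs : ∀ S : Finset V, S.card = s → ¬ IsIndep G₀ S)
    (hM : 2 * ((G₀.card + M) * (k.choose 2 * (Fintype.card V - 2).choose (k - 2)))
      ≤ (Fintype.card V).choose k) (hN : 0 < (Fintype.card V).choose k) :
    ∃ G : Finset (Finset V), (∀ e ∈ G, e.card = k) ∧ IsLinear G ∧
      (Fintype.card V).choose k ^ M
        ≤ Fintype.card V ^ (s * vartheta k G) * (2 ^ M * M.factorial) := by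
  have hcount := pow_le_card_linearExtensions hk hGk hG hM le_rfl
  have hne : (linearExtensions k G₀ M).Nonempty := by
    rw [nonempty_iff_ne_empty]
    intro h
    rw [h, card_empty, zero_mul] at hcount
    exact absurd hcount (by have := pow_pos hN M; omega)
  obtain ⟨G, hG', hmax⟩ := exists_max_image _ (vartheta k) hne
  obtain ⟨h1, -, h3, -⟩ := mem_linearExtensions.1 hG'
  refine ⟨G, h1, h3, hcount.trans (Nat.mul_le_mul_right _ ?_)⟩
  refine card_le_of_vartheta_le (by omega) hV (fun H hH => (mem_linearExtensions.1 hH).1)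
    (fun H hH S hS hind => ?_) hmax
  exact hs S hS fun e he => hind e ((mem_linearExtensions.1 hH).2.1 he)

lemma sq_le_four_mul_choose_two {m : ℕ} (hm : 2 ≤ m) : m ^ 2 ≤ 4 * m.choose 2 := by
  have h1 : m.choose 2 * 2 = m * (m - 1) := by
    rw [Nat.choose_two_right, Nat.div_mul_cancel (Nat.even_mul_pred_self m).two_dvd]
  obtain ⟨m, rfl⟩ := Nat.exists_eq_add_of_le hm
  have h2 : 2 + m - 1 = 1 + m := by omega
  rw [h2] at h1
  nlinarith

lemma two_mul_mul_le_choose {m k D : ℕ} (hk : 2 ≤ k)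
    (hD : 2 * k.choose 2 ^ 2 * D ≤ m.choose 2) :
    2 * (D * (k.choose 2 * (m - 2).choose (k - 2))) ≤ m.choose k := by
  refine Nat.le_of_mul_le_mul_right ?_ (Nat.choose_pos hk)
  rw [Nat.choose_mul hk]
  calc _ = 2 * k.choose 2 ^ 2 * D * (m - 2).choose (k - 2) := by ring
    _ ≤ _ := Nat.mul_le_mul_right _ hD

lemma pow_mul_choose_le {n s k : ℕ} (hs : 2 * k ≤ s) :
    (s : ℝ) ^ k * n.choose k ≤ 2 ^ k * n ^ k * s.choose k := by
  have h1 : ((s + 1 - k : ℕ) : ℝ) ^ k ≤ k.factorial * s.choose k := by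
    have := Nat.pow_sub_le_descFactorial s k
    rw [Nat.descFactorial_eq_factorial_mul_choose] at this
    exact_mod_cast this
  have h2 : (k.factorial : ℝ) * n.choose k ≤ (n : ℝ) ^ k := by
    have := Nat.descFactorial_le_pow n k
    rw [Nat.descFactorial_eq_factorial_mul_choose] at this
    exact_mod_cast this
  have h3 : (s : ℝ) ^ k ≤ 2 ^ k * ((s + 1 - k : ℕ) : ℝ) ^ k := by
    rw [← mul_pow]
    refine pow_le_pow_left₀ (by positivity) ?_ k
    exact_mod_cast (by omega : s ≤ 2 * (s + 1 - k))
  have hf : (0 : ℝ) < k.factorial := by exact_mod_cast k.factorial_pos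
  refine le_of_mul_le_mul_left ?_ hf
  calc (k.factorial : ℝ) * (s ^ k * n.choose k) = s ^ k * (k.factorial * n.choose k) := by ring
    _ ≤ (2 ^ k * (k.factorial * s.choose k)) * n ^ k := by
      gcongr
      exact h3.trans (by gcongr)
    _ = _ := by ring

lemma le_two_mul_of_choose_pow_le {n k M m : ℕ} (hk : 3 ≤ k) (hn : 2 * k ≤ n)
    (hnf : k.factorial ^ 2 ≤ n) (hM : 16 * k.choose 2 ^ 3 * M ≤ n.choose 2)
    (h : n.choose k ^ M ≤ n ^ m * (2 ^ M * M.factorial)) : M ≤ 2 * m := by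
  rcases Nat.eq_zero_or_pos M with rfl | hM0
  · exact Nat.zero_le _
  set K := k.choose 2 with hK
  have hK1 : 1 ≤ K := Nat.choose_pos (by omega)
  set C := (n - 2).choose (k - 2) with hC
  have hCn : n ≤ 2 * k.factorial * C := by
    have h1 := Nat.pow_sub_le_descFactorial (n - 2) (k - 2)
    rw [Nat.descFactorial_eq_factorial_mul_choose] at h1
    have h2 : n - 2 + 1 - (k - 2) ≤ (n - 2 + 1 - (k - 2)) ^ (k - 2) :=
      Nat.le_self_pow (by omega) _
    have h3 : (k - 2).factorial * C ≤ k.factorial * C :=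
      Nat.mul_le_mul_right _ (Nat.factorial_le (by omega))
    have h4 : n ≤ 2 * (n - 2 + 1 - (k - 2)) := by omega
    nlinarith
  have hN : 16 * K ^ 2 * M * C ≤ n.choose k := by
    refine Nat.le_of_mul_le_mul_right ?_ hK1
    rw [Nat.choose_mul (by omega)]
    calc _ = 16 * K ^ 3 * M * C := by ring
      _ ≤ _ := Nat.mul_le_mul_right _ hM
  have hNn : 2 * M * n ≤ k.factorial * n.choose k := by
    calc 2 * M * n ≤ 2 * M * (2 * k.factorial * C) := Nat.mul_le_mul_left _ hCn
      _ = k.factorial * (4 * 1 ^ 2 * M * C) := by ring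
      _ ≤ k.factorial * (16 * K ^ 2 * M * C) := by gcongr; norm_num
      _ ≤ _ := Nat.mul_le_mul_left _ hN
  have hsq : (2 * M) ^ 2 * n ≤ n.choose k ^ 2 := by
    have hn0 : 0 < n := by omega
    refine Nat.le_of_mul_le_mul_right ?_ hn0
    calc (2 * M) ^ 2 * n * n = (2 * M * n) ^ 2 := by ring
      _ ≤ (k.factorial * n.choose k) ^ 2 := Nat.pow_le_pow_left hNn 2
      _ = n.choose k ^ 2 * k.factorial ^ 2 := by ring
      _ ≤ _ := Nat.mul_le_mul_left _ hnf
  have h1 : n.choose k ^ M ≤ n ^ m * (2 * M) ^ M :=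
    h.trans (by rw [mul_pow]; gcongr; exact Nat.factorial_le_pow M)
  have h2 : n ^ M * (2 * M) ^ (2 * M) ≤ n ^ (2 * m) * (2 * M) ^ (2 * M) := by
    calc n ^ M * (2 * M) ^ (2 * M) = ((2 * M) ^ 2 * n) ^ M := by
          rw [mul_pow _ n, ← pow_mul, mul_comm]
      _ ≤ (n.choose k ^ 2) ^ M := Nat.pow_le_pow_left hsq M
      _ = (n.choose k ^ M) ^ 2 := by rw [← pow_mul, ← pow_mul, mul_comm]
      _ ≤ (n ^ m * (2 * M) ^ M) ^ 2 := Nat.pow_le_pow_left h1 2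
      _ = _ := by rw [mul_pow (n ^ m), ← pow_mul, ← pow_mul, mul_comm m, mul_comm M]
  exact (Nat.pow_le_pow_iff_right (by omega)).1
    (Nat.le_of_mul_le_mul_right h2 (by positivity))

lemma one_add_pow_le_exp {x : ℝ} (hx : 0 ≤ 1 + x) (m : ℕ) : (1 + x) ^ m ≤ Real.exp (m * x) := by
  rw [Real.exp_nat_mul]
  exact pow_le_pow_left₀ hx (by linarith [Real.add_one_le_exp x]) m

lemma exists_sq_le_mul_vartheta {k n s : ℕ} (hk : 3 ≤ k) (hks : 2 * k ≤ s) (hsn : s ≤ n)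
    (hnK : 128 * k.choose 2 ^ 3 ≤ n) (hnf : k.factorial ^ 2 ≤ n) (hlog : 1 ≤ Real.log n)
    (hs1 : 16 * (k.choose 2 : ℝ) ^ 2 * (Real.log n + 1) ≤ s)
    (hs2 : 2 * (2 ^ (k + 8) * (k.choose 2 : ℝ) ^ 3) * ((n : ℝ) ^ (k - 2) * Real.log n)
      ≤ (s : ℝ) ^ (k - 1)) :
    ∃ G : Finset (Finset (Fin n)), (∀ e ∈ G, e.card = k) ∧ IsLinear G ∧
      (n : ℝ) ^ 2 ≤ 256 * (k.choose 2 : ℝ) ^ 3 * s * vartheta k G := by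
  set K := k.choose 2 with hK
  have hK1 : 1 ≤ K := Nat.choose_pos (by omega)
  have hK1' : (1 : ℝ) ≤ K := by exact_mod_cast hK1
  set M := n.choose 2 / (16 * K ^ 3) with hMdef
  set D := s.choose 2 / (2 * K ^ 2) with hDdef
  have hMB : 16 * K ^ 3 * M ≤ n.choose 2 := Nat.mul_div_le _ _
  have hDs : 2 * K ^ 2 * D ≤ s.choose 2 := Nat.mul_div_le _ _
  have hN : 0 < n.choose k := Nat.choose_pos (by omega)
  have hN' : (0 : ℝ) < n.choose k := by exact_mod_cast hN
  have hB' : (0 : ℝ) < n.choose 2 := by exact_mod_cast Nat.choose_pos (by omega)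
  have hn0 : (0 : ℝ) < n := by exact_mod_cast (by omega : 0 < n)
  have hs2' : (2 : ℝ) ≤ s := by exact_mod_cast (by omega : 2 ≤ s)
  have hKpow : K ^ 2 ≤ K ^ 3 := Nat.pow_le_pow_right hK1 (by omega)
  have hM2 : 2 * K ^ 2 * (M + M) ≤ n.choose 2 := by nlinarith
  have hM1 : 2 * K ^ 2 * M ≤ n.choose 2 := by nlinarith
  have hMlow : (n : ℝ) ^ 2 ≤ 128 * (K : ℝ) ^ 3 * M := by
    have h1 : n.choose 2 < 16 * K ^ 3 * (M + 1) := by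
      rw [mul_comm]
      exact Nat.lt_mul_of_div_lt (Nat.lt_succ_self _) (by positivity)
    have h2 := sq_le_four_mul_choose_two (by omega : 2 ≤ n)
    have h3 : 128 * K ^ 3 ≤ n ^ 2 := hnK.trans (Nat.le_self_pow (by omega) n)
    have : n ^ 2 ≤ 128 * K ^ 3 * M := by linarith
    exact_mod_cast this
  set ρ : ℝ := s.choose k / (2 * n.choose k) with hρ
  set τ : ℝ := 2 * (s.choose 2 * (n - 2).choose (k - 2)) / n.choose k with hτ
  have hρ1 : ρ ≤ 1 := by
    rw [hρ, div_le_one (by positivity)]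
    have : (s.choose k : ℝ) ≤ n.choose k := by exact_mod_cast Nat.choose_le_choose k hsn
    linarith
  have hτM : 2 * τ * M ≤ (s.choose 2 : ℝ) / (4 * K ^ 2) := by
    have h1 : (n.choose k : ℝ) * K = n.choose 2 * (n - 2).choose (k - 2) := by
      exact_mod_cast Nat.choose_mul (by omega)
    have h2 : (16 : ℝ) * K ^ 3 * M ≤ n.choose 2 := by exact_mod_cast hMB
    have h3 : τ = 2 * s.choose 2 * K / n.choose 2 := by
      rw [hτ, div_eq_div_iff hN'.ne' hB'.ne']
      linear_combination (-2 * (s.choose 2 : ℝ)) * h1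
    rw [h3, le_div_iff₀ (by positivity)]
    have h4 : 2 * (2 * (s.choose 2 : ℝ) * K / n.choose 2) * M * (4 * K ^ 2)
        = s.choose 2 * (16 * K ^ 3 * M) / n.choose 2 := by
      field_simp
      ring
    rw [h4, div_le_iff₀ hB']
    exact mul_le_mul_of_nonneg_left h2 (by positivity)
  have hDlow : (s.choose 2 : ℝ) / (2 * K ^ 2) - 1 ≤ D := by
    have h1 : s.choose 2 < 2 * K ^ 2 * (D + 1) := by
      rw [mul_comm]
      exact Nat.lt_mul_of_div_lt (Nat.lt_succ_self _) (by positivity)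
    have h2 : (s.choose 2 : ℝ) ≤ (D + 1) * (2 * K ^ 2) := by
      rw [mul_comm]
      exact_mod_cast h1.le
    rw [← div_le_iff₀ (by positivity)] at h2
    linarith
  have hsq : (s : ℝ) * Real.log n + 2 ≤ (s.choose 2 : ℝ) / (4 * K ^ 2) := by
    have h1 : (s : ℝ) ^ 2 ≤ 4 * s.choose 2 := by
      exact_mod_cast sq_le_four_mul_choose_two (by omega : 2 ≤ s)
    rw [le_div_iff₀ (by positivity)]
    have h2 := mul_le_mul_of_nonneg_left hs1 (by linarith : (0 : ℝ) ≤ s)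
    have h3 : (s : ℝ) * Real.log n + 2 ≤ s * (Real.log n + 1) := by linarith
    have h4 := mul_le_mul_of_nonneg_right h3 (by positivity : (0 : ℝ) ≤ 4 * (K : ℝ) ^ 2)
    linarith
  have hρM : (s : ℝ) * Real.log n + 1 ≤ ρ * M := by
    have h1 : (s : ℝ) ^ k / (2 ^ (k + 1) * n ^ k) ≤ ρ := by
      rw [hρ, div_le_div_iff₀ (by positivity) (by positivity)]
      have := pow_mul_choose_le (n := n) hks
      rw [pow_succ]
      linarith
    have h2 : (n : ℝ) ^ 2 / (128 * K ^ 3) ≤ M := by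
      rw [div_le_iff₀ (by positivity)]
      linarith
    have h3 := mul_le_mul h1 h2 (by positivity) (le_trans (by positivity) h1)
    refine le_trans ?_ h3
    rw [div_mul_div_comm, le_div_iff₀ (by positivity)]
    have h4 : (s : ℝ) ^ k = s * s ^ (k - 1) := by rw [← pow_succ']; congr 1; omega
    have h5 : (n : ℝ) ^ k = n ^ (k - 2) * n ^ 2 := by rw [← pow_add]; congr 1; omega
    have h6 : (2 : ℝ) ^ (k + 8) = 2 ^ (k + 1) * 128 := by rw [pow_add, pow_add]; ring
    have h7 := mul_le_mul_of_nonneg_left hs2 (by positivity : (0 : ℝ) ≤ s * n ^ 2)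
    have h8 : (s : ℝ) * Real.log n + 1 ≤ 2 * (s * Real.log n) := by nlinarith
    have h9 := mul_le_mul_of_nonneg_right h8
      (by positivity : (0 : ℝ) ≤ 2 ^ (k + 1) * n ^ k * (128 * K ^ 3))
    refine h9.trans ?_
    rw [h4, h5]
    rw [h6] at h7
    linarith
  have hΦ : ((Fintype.card (Fin n)).choose s : ℝ)
      * ((1 - ρ) ^ M + Real.exp (-D) * (1 + 2 * τ) ^ M) < 1 := by
    rw [Fintype.card_fin]
    have hns : (n.choose s : ℝ) ≤ Real.exp (s * Real.log n) := by
      rw [Real.exp_nat_mul, Real.exp_log hn0]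
      exact_mod_cast Nat.choose_le_pow n s
    have h1 : (1 - ρ) ^ M ≤ Real.exp (-(ρ * M)) := by
      have := one_add_pow_le_exp (x := -ρ) (by linarith) M
      rwa [← sub_eq_add_neg, show (M : ℝ) * -ρ = -(ρ * M) by ring] at this
    have h2 : Real.exp (-D) * (1 + 2 * τ) ^ M ≤ Real.exp (-D + 2 * τ * M) := by
      rw [Real.exp_add]
      have := one_add_pow_le_exp (x := 2 * τ) (by positivity) M
      rw [mul_comm (M : ℝ)] at this
      gcongr
    have h3 : Real.exp (s * Real.log n) * Real.exp (-(ρ * M)) ≤ Real.exp (-1) := by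
      rw [← Real.exp_add]
      exact Real.exp_le_exp.2 (by linarith)
    have h4 : Real.exp (s * Real.log n) * Real.exp (-D + 2 * τ * M) ≤ Real.exp (-1) := by
      rw [← Real.exp_add]
      refine Real.exp_le_exp.2 ?_
      have : (s.choose 2 : ℝ) / (2 * K ^ 2) = 2 * (s.choose 2 / (4 * K ^ 2)) := by
        field_simp
        ring
      linarith
    have h5 : Real.exp (-1) < 1 / 2 := by
      have := Real.exp_neg_one_lt_d9
      linarith
    calc _ ≤ Real.exp (s * Real.log n)
          * (Real.exp (-(ρ * M)) + Real.exp (-D + 2 * τ * M)) := by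
          have : 0 ≤ (1 - ρ) ^ M := pow_nonneg (by linarith) _
          gcongr
      _ < 1 := by linarith
  obtain ⟨G₀, hGk, hG, hGM, hind⟩ := exists_isLinear_forall_not_isIndep (V := Fin n) (k := k)
    (s := s) (D := D) (M := M) (ρ := ρ) (τ := τ) (by omega) (by positivity) hρ1 (by positivity)
    (by simpa using hN) (by simpa using two_mul_mul_le_choose (by omega) hM1)
    (two_mul_mul_le_choose (by omega) hDs)
    (by
      rw [Fintype.card_fin, hρ]
      refine le_of_eq ?_
      field_simp)
    (by
      rw [Fintype.card_fin, hτ]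
      refine le_of_eq ?_
      field_simp)
    hΦ
  obtain ⟨G, hGk', hG', hle⟩ := exists_isLinear_choose_pow_le (M := M) (by omega)
    (by simp only [Fintype.card_fin]; omega) hGk hG hind
    (by simpa [hGM] using two_mul_mul_le_choose (by omega) hM2) (by simpa using hN)
  rw [Fintype.card_fin] at hle
  refine ⟨G, hGk', hG', ?_⟩
  have h1 : (M : ℝ) ≤ 2 * (s * vartheta k G) := by
    exact_mod_cast le_two_mul_of_choose_pow_le hk (by omega) hnf hMB hle
  have h2 := mul_le_mul_of_nonneg_left h1 (by positivity : (0 : ℝ) ≤ 128 * (K : ℝ) ^ 3)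
  linarith

/-- The upper bound of the theorem, with `r = n ^ (1 / (k - 1))`. -/
lemma vartheta_le_mul_log {k n : ℕ} (hk : 3 ≤ k) {r : ℝ} (hr1 : 1 ≤ r) (hr : r ^ (k - 1) = n)
    (hlog : 1 ≤ Real.log n) {G : Finset (Finset (Fin n))} (hGk : ∀ e ∈ G, e.card = k)
    (hG : IsLinear G) :
    (vartheta k G : ℝ) ≤ 2 * (k + 1) * (2 * (4 * k ^ 2)) ^ k * r ^ k * Real.log n := by
  have hk' : (3 : ℝ) ≤ k := by exact_mod_cast hk
  set a : ℝ := 4 * k ^ 2 with ha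
  have ha1 : 1 ≤ a := by nlinarith
  have har : 1 ≤ a * r := by nlinarith
  set q := ⌈a * r⌉₊ with hq
  have hqa : a * r ≤ q := Nat.le_ceil _
  have hq2 : (q : ℝ) ≤ 2 * a * r := by
    have := Nat.ceil_lt_add_one (by linarith : 0 ≤ a * r)
    linarith
  have hq1 : (1 : ℝ) ≤ q := har.trans hqa
  have hn0 : (0 : ℝ) < n := by rw [← hr]; positivity
  set Q : ℝ := 2 * q ^ k with hQ
  have hqk : (1 : ℝ) ≤ (q : ℝ) ^ k := one_le_pow₀ hq1
  have hQ2 : 2 ≤ Q := by linarith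
  set t := ⌈k * Real.log n * Q⌉₊ + 1 with ht
  have htlow : k * Real.log n * Q < t := by
    rw [ht]
    push_cast
    linarith [Nat.le_ceil (k * Real.log n * Q)]
  have hthigh : (t : ℝ) ≤ (k + 1) * Real.log n * Q := by
    have h1 := Nat.ceil_lt_add_one (by positivity : 0 ≤ k * Real.log n * Q)
    have h2 : 2 ≤ Real.log n * Q := by nlinarith
    rw [ht]
    push_cast
    linarith
  have hle : vartheta k G ≤ t := by
    refine hG.vartheta_le_of_colors (q := q) (by omega) (by exact_mod_cast hq1) hGk ?_ ?_ ?_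
    · have h1 : a ^ (k - 1) * n ≤ (q : ℝ) ^ (k - 1) := by
        rw [← hr, ← mul_pow]
        exact pow_le_pow_left₀ (by positivity) hqa _
      have h2 : a ≤ a ^ (k - 1) := le_self_pow₀ ha1 (by omega)
      have h3 : 4 * (k * n : ℝ) ≤ a * n := by
        rw [← mul_assoc]
        refine mul_le_mul_of_nonneg_right ?_ hn0.le
        rw [ha]
        nlinarith
      have h4 := mul_le_mul_of_nonneg_right h2 hn0.le
      rw [Fintype.card_fin]
      exact_mod_cast h3.trans (h4.trans h1)
    · have h1 : (k.choose 2 : ℝ) ≤ k ^ 2 := by exact_mod_cast Nat.choose_le_pow k 2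
      have h2 : 4 * (k.choose 2 : ℝ) ≤ q := by
        have : a ≤ a * r := le_mul_of_one_le_right (by linarith) hr1
        linarith
      exact_mod_cast h2
    · rw [Fintype.card_fin]
      have hnk : (n : ℝ) ^ k = Real.exp (k * Real.log n) := by
        rw [Real.exp_nat_mul, Real.exp_log hn0]
      have hpow : (1 - 1 / Q) ^ t ≤ Real.exp (-(t / Q)) := by
        have h1 : 1 / Q ≤ 1 := (div_le_one (by linarith)).2 (by linarith)
        have := one_add_pow_le_exp (x := -(1 / Q)) (by linarith) t
        rwa [← sub_eq_add_neg, show (t : ℝ) * -(1 / Q) = -(t / Q) by ring] at this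
      calc (1 - 1 / Q) ^ t * (n : ℝ) ^ k ≤ Real.exp (-(t / Q)) * Real.exp (k * Real.log n) := by
            rw [hnk]
            gcongr
        _ = Real.exp (-(t / Q) + k * Real.log n) := (Real.exp_add _ _).symm
        _ < 1 := by
          rw [Real.exp_lt_one_iff]
          have : k * Real.log n < t / Q := (lt_div_iff₀ (by linarith)).2 htlow
          linarith
  have hle' : (vartheta k G : ℝ) ≤ t := by exact_mod_cast hle
  refine hle'.trans (hthigh.trans ?_)
  have hqk2 : (q : ℝ) ^ k ≤ (2 * a) ^ k * r ^ k := by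
    rw [← mul_pow]
    exact pow_le_pow_left₀ (by positivity) hq2 k
  rw [hQ]
  have := mul_le_mul_of_nonneg_left hqk2
    (by positivity : 0 ≤ (k + 1 : ℝ) * Real.log n * 2)
  linarith

/-- The lower bound of the theorem, with `r = n ^ (1 / (k - 1))` and
`L = (log n) ^ (1 / (k - 1))`. -/
lemma exists_le_vartheta {k n : ℕ} (hk : 3 ≤ k) {C r L : ℝ}
    (hC : C = 2 ^ (k + 9) * (k.choose 2 : ℝ) ^ 3) (hr1 : 1 ≤ r) (hr : r ^ (k - 1) = n)
    (hL1 : 1 ≤ L) (hL : L ^ (k - 1) = Real.log n)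
    (hCr : 2 * C * (Real.log n + 1) ≤ r) (hnf : k.factorial ^ 2 ≤ n) :
    ∃ G : Finset (Finset (Fin n)), (∀ e ∈ G, e.card = k) ∧ IsLinear G ∧
      1 / (512 * (k.choose 2 : ℝ) ^ 3 * C) * r ^ k / L ≤ vartheta k G := by
  set K := k.choose 2 with hK
  have hK1 : (1 : ℝ) ≤ K := by exact_mod_cast Nat.choose_pos (by omega : 2 ≤ k)
  have hlog : 1 ≤ Real.log n := hL ▸ one_le_pow₀ hL1
  have hLlog : L ≤ Real.log n := hL ▸ le_self_pow₀ hL1 (by omega)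
  have hK3 : (1 : ℝ) ≤ (K : ℝ) ^ 3 := one_le_pow₀ hK1
  have h2k : (k : ℝ) + 9 ≤ 2 ^ (k + 9) := by exact_mod_cast (k + 9).lt_two_pow_self.le
  have h512 : (512 : ℝ) ≤ 2 ^ (k + 9) := by
    rw [pow_add]
    have : (1 : ℝ) ≤ 2 ^ k := one_le_pow₀ (by norm_num)
    linarith
  have hCK : 512 * (K : ℝ) ^ 3 ≤ C := by
    rw [hC]
    exact mul_le_mul_of_nonneg_right h512 (by positivity)
  have hC1 : 1 ≤ C := by linarith
  have hCk : (k : ℝ) ≤ C := by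
    rw [hC]
    nlinarith
  have hrC : 2 * C ≤ r := by nlinarith
  have hrn : r ≤ n := hr ▸ le_self_pow₀ hr1 (by omega)
  set x := C * (r ^ (k - 2) * L) with hx
  have hrp : r ≤ r ^ (k - 2) := le_self_pow₀ hr1 (by omega)
  have hrx : r ≤ x := by
    have h1 : r ≤ r ^ (k - 2) * L := by nlinarith
    nlinarith
  set s := ⌈x⌉₊ with hs
  have hxs : x ≤ s := Nat.le_ceil _
  have hsx : (s : ℝ) ≤ 2 * x := by
    have := Nat.ceil_lt_add_one (by linarith : 0 ≤ x)
    linarith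
  have hrs : r ≤ s := hrx.trans hxs
  have hrk : r ^ (k - 1) = r * r ^ (k - 2) := by rw [← pow_succ']; congr 1; omega
  have hpos : 0 < r ^ (k - 2) := by positivity
  have hsn : (s : ℝ) ≤ n := by
    have h1 : 2 * C * L ≤ r := le_trans (by gcongr; linarith) hCr
    have h2 := mul_le_mul_of_nonneg_right h1 hpos.le
    rw [← hr, hrk]
    linarith
  obtain ⟨G, hGk, hG, hle⟩ := exists_sq_le_mul_vartheta (k := k) (n := n) (s := s) hk
    (by
      have : 2 * (k : ℝ) ≤ s := by linarith
      exact_mod_cast this)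
    (by exact_mod_cast hsn)
    (by
      have : 128 * (K : ℝ) ^ 3 ≤ n := by linarith
      exact_mod_cast this)
    hnf hlog
    (by
      have h1 : (K : ℝ) ^ 2 ≤ K ^ 3 := pow_le_pow_right₀ hK1 (by norm_num)
      refine le_trans ?_ (hCr.trans hrs)
      refine mul_le_mul_of_nonneg_right ?_ (by linarith)
      linarith)
    (by
      refine le_trans ?_ (pow_le_pow_left₀ (by linarith) hxs (k - 1))
      rw [hx, mul_pow, mul_pow, hL, ← pow_mul, mul_comm (k - 2), pow_mul, hr]
      refine mul_le_mul_of_nonneg_right ?_ (by positivity)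
      refine le_trans (le_of_eq ?_) (le_self_pow₀ hC1 (by omega : k - 1 ≠ 0))
      rw [hC, pow_succ 2 (k + 8)]
      ring)
  refine ⟨G, hGk, hG, ?_⟩
  have h1 : (n : ℝ) ^ 2 = r ^ (k - 2) * r ^ k := by
    rw [← hr, ← pow_mul, ← pow_add]
    congr 1
    omega
  rw [h1] at hle
  have h2 : r ^ (k - 2) * r ^ k
      ≤ r ^ (k - 2) * (512 * (K : ℝ) ^ 3 * C * L * vartheta k G) := by
    have := mul_le_mul_of_nonneg_left hsx
      (by positivity : (0 : ℝ) ≤ 256 * (K : ℝ) ^ 3 * vartheta k G)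
    rw [hx] at this
    linarith
  have h3 := le_of_mul_le_mul_left h2 hpos
  rw [div_mul_eq_mul_div, one_mul, div_div, div_le_iff₀ (by positivity)]
  linarith

/-- For every `k ≥ 3` there exist positive constants `c₁, c₂` depending only on `k` and an
`n₀` such that for all `n ≥ n₀`: every linear `k`-graph `G` on `n` vertices satisfies
`ϑ(G) ≤ c₂ n^{k/(k-1)} log n`, and some linear `k`-graph `G` on `n` vertices satisfies
`ϑ(G) ≥ c₁ n^{k/(k-1)} / (log n)^{1/(k-1)}`. -/
theorem linear_bounds (k : ℕ) (hk : 3 ≤ k) :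
    ∃ c₁ c₂ : ℝ, 0 < c₁ ∧ 0 < c₂ ∧ ∃ n₀ : ℕ, ∀ n : ℕ, n₀ ≤ n →
      (∀ G : Finset (Finset (Fin n)), (∀ e ∈ G, e.card = k) → IsLinear G →
        (vartheta k G : ℝ) ≤ c₂ * (n : ℝ) ^ ((k : ℝ) / ((k : ℝ) - 1)) * Real.log n) ∧
      (∃ G : Finset (Finset (Fin n)), (∀ e ∈ G, e.card = k) ∧ IsLinear G ∧
        c₁ * (n : ℝ) ^ ((k : ℝ) / ((k : ℝ) - 1)) / (Real.log n) ^ ((1 : ℝ) / ((k : ℝ) - 1))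
          ≤ (vartheta k G : ℝ)) := by
  set C : ℝ := 2 ^ (k + 9) * (k.choose 2 : ℝ) ^ 3 with hC
  have hK : (0 : ℝ) < k.choose 2 := by exact_mod_cast Nat.choose_pos (by omega : 2 ≤ k)
  have hk' : (3 : ℝ) ≤ k := by exact_mod_cast hk
  have hkm : ((k - 1 : ℕ) : ℝ) = (k : ℝ) - 1 := by
    rw [Nat.cast_sub (by omega), Nat.cast_one]
  have hexp : (0 : ℝ) < 1 / ((k : ℝ) - 1) := by
    have : (0 : ℝ) < (k : ℝ) - 1 := by linarith
    positivity
  have hroot : ∀ x : ℝ, 0 ≤ x → (x ^ (1 / ((k : ℝ) - 1))) ^ (k - 1) = x := by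
    intro x hx
    rw [← Real.rpow_natCast, ← Real.rpow_mul hx, hkm, one_div_mul_cancel (by linarith),
      Real.rpow_one]
  have hrpow : ∀ x : ℝ, 0 ≤ x → x ^ ((k : ℝ) / ((k : ℝ) - 1)) = (x ^ (1 / ((k : ℝ) - 1))) ^ k := by
    intro x hx
    rw [← Real.rpow_natCast, ← Real.rpow_mul hx, one_div_mul_eq_div]
  have hlogev : ∀ᶠ n : ℕ in Filter.atTop, 1 ≤ Real.log n :=
    (Real.tendsto_log_atTop.comp tendsto_natCast_atTop_atTop).eventually_ge_atTop 1
  have hlittle : ∀ᶠ n : ℕ in Filter.atTop,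
      ‖Real.log n‖ ≤ 1 / (4 * C) * ‖(n : ℝ) ^ (1 / ((k : ℝ) - 1))‖ :=
    tendsto_natCast_atTop_atTop.eventually
      ((isLittleO_log_rpow_atTop hexp).bound (by positivity : 0 < 1 / (4 * C)))
  obtain ⟨n₀, hn₀⟩ := Filter.eventually_atTop.1
    (hlogev.and (hlittle.and (Filter.eventually_ge_atTop (k.factorial ^ 2))))
  refine ⟨1 / (512 * (k.choose 2 : ℝ) ^ 3 * C), 2 * (k + 1) * (2 * (4 * k ^ 2)) ^ k,
    by positivity, by positivity, n₀, fun n hn => ?_⟩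
  obtain ⟨hlog, hlit, hnf⟩ := hn₀ n hn
  have hn1 : (1 : ℝ) ≤ n := by
    exact_mod_cast (pow_pos k.factorial_pos 2).trans_le hnf
  have hr1 := Real.one_le_rpow hn1 hexp.le
  have hL1 := Real.one_le_rpow hlog hexp.le
  rw [hrpow n (by linarith)]
  refine ⟨fun G hGk hG => vartheta_le_mul_log hk hr1 (hroot n (by linarith)) hlog hGk hG,
    exists_le_vartheta hk hC hr1 (hroot n (by linarith)) hL1 (hroot _ (by linarith)) ?_ hnf⟩
  rw [Real.norm_of_nonneg (by linarith), Real.norm_of_nonneg (by linarith), one_div_mul_eq_div,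
    le_div_iff₀ (by positivity)] at hlit
  have hC0 : 0 < C := by positivity
  nlinarith
end

section
/- Let n, d, k ≥ 2 and let c = 2^{k+2} · k^{k+1}. If G is a d-balanced k-graph on n vertices, then ϑ(G) ≤ c · d^{k/(k-1)} · log n. -/
open Finset

variable {V : Type*} [DecidableEq V]

/-- The probability that a random subset containing each point independently with probability `p`
equals `W`. -/
def subsetWeight [Fintype V] (p : ℝ) (W : Finset V) : ℝ :=
  p ^ W.card * (1 - p) ^ (univ \ W).card

lemma subsetWeight_nonneg [Fintype V] {p : ℝ} (h0 : 0 ≤ p) (h1 : p ≤ 1) (W : Finset V) :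
    0 ≤ subsetWeight p W :=
  mul_nonneg (pow_nonneg h0 _) (pow_nonneg (sub_nonneg.2 h1) _)

lemma sum_subsetWeight_superset [Fintype V] (p : ℝ) (A : Finset V) :
    ∑ W : Finset V, (if A ⊆ W then subsetWeight p W else 0) = p ^ A.card := by
  have h := Finset.prod_add (fun _ : V => p) (fun v => if v ∈ A then 0 else 1 - p) univ
  have hl : ∏ v : V, (p + if v ∈ A then 0 else 1 - p) = p ^ A.card := by
    have : ∀ v : V, (p + if v ∈ A then 0 else 1 - p) = if v ∈ A then p else 1 := by
      intro v; split_ifs <;> ring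
    simp only [this]
    rw [Finset.prod_ite_mem, univ_inter, prod_const]
  rw [← hl, h, powerset_univ]
  refine sum_congr rfl fun W _ => ?_
  rw [prod_const]
  split_ifs with hA
  · rw [subsetWeight]
    congr 1
    rw [← prod_const]
    refine prod_congr rfl fun v hv => ?_
    rw [if_neg fun hvA => (mem_sdiff.1 hv).2 (hA hvA)]
  · obtain ⟨v, hvA, hvW⟩ := not_subset.1 hA
    rw [prod_eq_zero (i := v) (by simp [hvW]) (by simp [hvA]), mul_zero]

/-- The points of `W` lying in no edge of `G` contained in `W`. -/
def prune (G : Finset (Finset V)) (W : Finset V) : Finset V :=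
  W.filter fun v => ∀ f ∈ G, f ⊆ W → v ∉ f

lemma isIndep_prune {G : Finset (Finset V)} (hG : ∅ ∉ G) (W : Finset V) :
    IsIndep G (prune G W) := by
  intro e he hsub
  obtain ⟨v, hv⟩ := nonempty_iff_ne_empty.2 fun h => hG (h ▸ he)
  exact (mem_filter.1 (hsub hv)).2 e he (hsub.trans (filter_subset _ _)) hv

lemma sum_subsetWeight_prune [Fintype V] {p : ℝ} (h0 : 0 ≤ p) (h1 : p ≤ 1)
    (G : Finset (Finset V)) (e : Finset V) :
    p ^ e.card - ∑ f ∈ G with (e ∩ f).Nonempty, p ^ (e ∪ f).card ≤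
      ∑ W : Finset V, (if e ⊆ prune G W then subsetWeight p W else 0) := by
  simp only [← sum_subsetWeight_superset]
  rw [sum_comm, ← sum_sub_distrib]
  refine sum_le_sum fun W _ => ?_
  have hw := subsetWeight_nonneg h0 h1 W
  have hnn : ∀ f ∈ G.filter (fun f => (e ∩ f).Nonempty),
      (0 : ℝ) ≤ if e ∪ f ⊆ W then subsetWeight p W else 0 := by
    intro f _; split_ifs <;> simp [hw]
  have hs := sum_nonneg hnn
  by_cases heW : e ⊆ W
  · by_cases hp : e ⊆ prune G W
    · rw [if_pos heW, if_pos hp]; linarith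
    · rw [if_pos heW, if_neg hp]
      obtain ⟨v, hve, hv⟩ := not_subset.1 hp
      simp only [prune, mem_filter, not_and, not_forall, not_not] at hv
      obtain ⟨f, hf, hfW, hvf⟩ := hv (heW hve)
      have := single_le_sum hnn (mem_filter.2 ⟨hf, ⟨v, mem_inter.2 ⟨hve, hvf⟩⟩⟩)
      rw [if_pos (union_subset heW hfW)] at this
      linarith
  · rw [if_neg heW]
    split_ifs <;> linarith

/-- If the codegrees of `G` are at most the powers of `q`, the edges meeting a given non-edge `e`
have small total weight. -/
lemma sum_pow_card_union_le {k : ℕ} {p q : ℝ} (h0 : 0 ≤ p)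
    {G : Finset (Finset V)} (hG : ∀ f ∈ G, f.card = k)
    (hdeg : ∀ S : Finset V, S.Nonempty → S.card ≤ k → (degS G S : ℝ) ≤ q ^ (k - S.card))
    (hq : 0 ≤ q) {e : Finset V} (he : e.card = k) (heG : e ∉ G) :
    ∑ f ∈ G with (e ∩ f).Nonempty, p ^ (e ∪ f).card ≤ p ^ k * ((1 + p * q) ^ k - 1) := by
  have hmaps : ∀ f ∈ G.filter (fun f => (e ∩ f).Nonempty),
      e ∩ f ∈ e.powerset.erase e := by
    intro f hf
    refine mem_erase.2 ⟨fun h => heG ?_, mem_powerset.2 inter_subset_left⟩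
    have hf := (mem_filter.1 hf).1
    rwa [eq_of_subset_of_card_le (inter_eq_left.1 h) (by rw [hG f hf, he])]
  have hbinom : ∑ S ∈ e.powerset.erase e, (p * q) ^ (k - S.card) = (1 + p * q) ^ k - 1 := by
    have h := sum_pow_mul_eq_add_pow (1 : ℝ) (p * q) e
    rw [← add_sum_erase _ _ (mem_powerset_self e)] at h
    simp only [one_pow, one_mul, he, Nat.sub_self, pow_zero] at h
    linarith
  rw [← sum_fiberwise_of_maps_to hmaps, ← hbinom, mul_sum]
  refine sum_le_sum fun S hS => ?_
  have hSe : S ⊆ e := mem_powerset.1 (mem_erase.1 hS).2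
  have hSk : S.card ≤ k := he ▸ card_le_card hSe
  rcases S.eq_empty_or_nonempty with rfl | hne
  · rw [sum_eq_zero]
    · positivity
    · intro f hf
      simp only [mem_filter] at hf
      exact absurd hf.2 hf.1.2.ne_empty
  calc _ ≤ ∑ f ∈ G.filter (fun f => S ⊆ f), p ^ (k + (k - S.card)) := by
        refine (sum_congr rfl fun f hf => ?_).trans_le
          (sum_le_sum_of_subset_of_nonneg (fun f hf => ?_) fun _ _ _ => by positivity)
        · simp only [mem_filter] at hf
          have := card_union_add_card_inter e f
          rw [hf.2, he, hG f hf.1.1] at this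
          congr 1
          omega
        · simp only [mem_filter] at hf ⊢
          exact ⟨hf.1.1, hf.2 ▸ inter_subset_right⟩
    _ = degS G S * p ^ (k + (k - S.card)) := by rw [sum_const, nsmul_eq_mul, degS]
    _ ≤ q ^ (k - S.card) * p ^ (k + (k - S.card)) := by gcongr; exact hdeg S hne hSk
    _ = _ := by rw [mul_pow, pow_add]; ring

/-- Averaging: if every member of `F` is covered with weight at least `δ` by the pruned sets,
then some pruned set covers a `δ` fraction of `F`. -/
lemma exists_prune_cover [Fintype V] {p δ : ℝ} (h0 : 0 ≤ p) (h1 : p ≤ 1)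
    (G F : Finset (Finset V))
    (hF : ∀ e ∈ F, δ ≤ ∑ W : Finset V, (if e ⊆ prune G W then subsetWeight p W else 0)) :
    ∃ W : Finset V, ((F.filter fun e => ¬ e ⊆ prune G W).card : ℝ) ≤ (1 - δ) * F.card := by
  by_contra! hcon
  have hlt : ∀ W : Finset V, ((F.filter fun e => e ⊆ prune G W).card : ℝ) < δ * F.card := by
    intro W
    have h := hcon W
    have h2 : ((F.filter fun e => e ⊆ prune G W).card : ℝ)
        + (F.filter fun e => ¬ e ⊆ prune G W).card = F.card := by
      exact_mod_cast card_filter_add_card_filter_not (s := F) (fun e => e ⊆ prune G W)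
    linarith
  have htot : ∑ W : Finset V, subsetWeight p W = 1 := by
    simpa using sum_subsetWeight_superset p (∅ : Finset V)
  have hle : δ * F.card ≤
      ∑ W : Finset V, subsetWeight p W * (F.filter fun e => e ⊆ prune G W).card := by
    calc δ * F.card = ∑ _e ∈ F, δ := by rw [sum_const, nsmul_eq_mul, mul_comm]
      _ ≤ _ := sum_le_sum hF
      _ = _ := by
        rw [sum_comm]
        refine sum_congr rfl fun W _ => ?_
        rw [← sum_filter, sum_const, nsmul_eq_mul, mul_comm]
  have hlt' : ∑ W : Finset V, subsetWeight p W * (F.filter fun e => e ⊆ prune G W).card <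
      ∑ W : Finset V, subsetWeight p W * (δ * F.card) := by
    refine sum_lt_sum (fun W _ =>
      mul_le_mul_of_nonneg_left (hlt W).le (subsetWeight_nonneg h0 h1 W)) ?_
    obtain ⟨W, hW, hpos⟩ := exists_lt_of_sum_lt
      (s := (univ : Finset (Finset V))) (f := fun _ => (0 : ℝ)) (g := subsetWeight p)
      (by simp [htot])
    exact ⟨W, hW, mul_lt_mul_of_pos_left (hlt W) hpos⟩
  rw [← sum_mul, htot, one_mul] at hlt'
  exact absurd hle (not_le.2 hlt')

/-- Iterating a step that leaves at most an `r` fraction of any family uncovered. -/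
lemma exists_iterated_cover {P : Finset V → Prop} {r : ℝ} (hr : 0 ≤ r) (F : Finset (Finset V))
    (hstep : ∀ F' ⊆ F, ∃ I, P I ∧ ((F'.filter fun e => ¬ e ⊆ I).card : ℝ) ≤ r * F'.card)
    (t : ℕ) :
    ∃ I : Fin t → Finset V, (∀ j, P (I j)) ∧
      ((F.filter fun e => ∀ j, ¬ e ⊆ I j).card : ℝ) ≤ r ^ t * F.card := by
  induction t with
  | zero => exact ⟨Fin.elim0, fun j => j.elim0, by simp⟩
  | succ t ih =>
    obtain ⟨I, hI, hcard⟩ := ih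
    obtain ⟨J, hJ, hJcard⟩ := hstep _ (filter_subset (fun e => ∀ j, ¬ e ⊆ I j) F)
    refine ⟨Fin.cons J I, Fin.cases hJ hI, ?_⟩
    have : (F.filter fun e => ∀ j, ¬ e ⊆ (Fin.cons J I : Fin (t + 1) → Finset V) j) =
        (F.filter fun e => ∀ j, ¬ e ⊆ I j).filter fun e => ¬ e ⊆ J := by
      ext e
      simp only [mem_filter, Fin.forall_fin_succ, Fin.cons_zero, Fin.cons_succ]
      tauto
    rw [this, pow_succ', mul_assoc]
    exact hJcard.trans (mul_le_mul_of_nonneg_left hcard hr)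

lemma one_add_inv_two_mul_pow_le {k : ℕ} (hk : 0 < k) :
    (1 + 1 / (2 * k : ℝ)) ^ k ≤ 7 / 4 := by
  have h : (1 + 1 / (2 * k : ℝ)) ^ k ≤ Real.exp (1 / 2) := by
    calc (1 + 1 / (2 * k : ℝ)) ^ k ≤ Real.exp (1 / (2 * k : ℝ)) ^ k := by
          gcongr
          linarith [Real.add_one_le_exp (1 / (2 * k : ℝ))]
      _ = Real.exp (1 / 2) := by
          rw [← Real.exp_nat_mul]
          congr 1
          field_simp
  have h2 : Real.exp (1 / 2) ^ 2 = Real.exp 1 := by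
    rw [← Real.exp_nat_mul]; norm_num
  have h3 := Real.exp_one_lt_d9
  have := Real.exp_pos (1 / 2)
  nlinarith

/-- A geometric decay estimate: `⌊k log n / δ⌋` rounds reduce `n choose k` below one. -/
lemma pow_floor_mul_choose_lt_one {n k : ℕ} (hn : 2 ≤ n) (hk : 2 ≤ k) {δ : ℝ} (hδ : 0 < δ)
    (hδ' : δ ≤ 1 / 4) :
    (1 - δ) ^ ⌊k * Real.log n / δ⌋₊ * (n.choose k : ℝ) < 1 := by
  set t := ⌊k * Real.log n / δ⌋₊ with ht
  have hn0 : (0 : ℝ) < n := by positivity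
  have hfl : k * Real.log n < δ * t + δ := by
    have := Nat.lt_floor_add_one (k * Real.log n / δ)
    rw [div_lt_iff₀ hδ] at this
    rw [ht]; linarith
  have hpow : (1 - δ) ^ t ≤ Real.exp (-(δ * t)) := by
    calc (1 - δ) ^ t ≤ Real.exp (-δ) ^ t := by
          gcongr
          · linarith
          · linarith [Real.add_one_le_exp (-δ)]
      _ = _ := by rw [← Real.exp_nat_mul]; congr 1; ring
  have hexp : Real.exp (-(δ * t)) * (n : ℝ) ^ k < 2 := by
    have hnk : (n : ℝ) ^ k = Real.exp (k * Real.log n) := by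
      rw [Real.exp_nat_mul, Real.exp_log hn0]
    rw [hnk, ← Real.exp_add]
    calc _ < Real.exp (1 / 4) := Real.exp_lt_exp.2 (by linarith)
      _ < 2 := by
        rw [← Real.lt_log_iff_exp_lt (by norm_num)]
        linarith [Real.log_two_gt_d9]
  have hch : (n.choose k : ℝ) ≤ (n : ℝ) ^ k / 2 := by
    refine (Nat.choose_le_pow_div k n).trans ?_
    gcongr
    exact_mod_cast hk.trans (Nat.self_le_factorial k)
  calc _ ≤ Real.exp (-(δ * t)) * ((n : ℝ) ^ k / 2) := by gcongr
    _ < 1 := by linarith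

/-- Let `n, d, k ≥ 2` and `c = 2^{k+2} k^{k+1}`. If `G` is a `d`-balanced `k`-graph on
`n` vertices, then `ϑ(G) ≤ c d^{k/(k-1)} log n`. -/
theorem balanced_upper (n d k : ℕ) (hn : 2 ≤ n) (hd : 2 ≤ d) (hk : 2 ≤ k)
    (G : Finset (Finset (Fin n))) (hG : ∀ e ∈ G, e.card = k) (hbal : IsBalanced k d G) :
    (vartheta k G : ℝ) ≤
      (2 ^ (k + 2) * k ^ (k + 1) : ℝ) * (d : ℝ) ^ ((k : ℝ) / ((k : ℝ) - 1)) * Real.log n := by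
  have hk1 : (0 : ℝ) < (k : ℝ) - 1 := by
    have : (2 : ℝ) ≤ k := by exact_mod_cast hk
    linarith
  have hd1 : (1 : ℝ) ≤ d := by exact_mod_cast (by omega : 1 ≤ d)
  have hk0 : (2 : ℝ) ≤ k := by exact_mod_cast hk
  set q : ℝ := (d : ℝ) ^ (1 / ((k : ℝ) - 1)) with hq
  have hq1 : 1 ≤ q := Real.one_le_rpow hd1 (by positivity)
  have hqpow : ∀ m : ℕ, (d : ℝ) ^ ((m : ℝ) / ((k : ℝ) - 1)) = q ^ m := by
    intro m
    rw [hq, ← Real.rpow_mul_natCast (by positivity)]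
    congr 1
    ring
  set p : ℝ := 1 / (2 * k * q) with hp
  have hp0 : 0 < p := by positivity
  have hp1 : p ≤ 1 := by
    rw [hp, div_le_one (by positivity)]
    nlinarith
  have hpq : p * q = 1 / (2 * k) := by
    rw [hp]; field_simp
  have hdeg : ∀ S : Finset (Fin n), S.Nonempty → S.card ≤ k →
      (degS G S : ℝ) ≤ q ^ (k - S.card) := by
    intro S hS hSk
    rw [← hqpow, Nat.cast_sub hSk]
    exact hbal _ hS.card_pos hSk S rfl
  have hempty : ∅ ∉ G := fun h => by
    have := hG _ h
    rw [card_empty] at this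
    omega
  set δ : ℝ := p ^ k / 4 with hδ
  have hδ0 : 0 < δ := by positivity
  have hδ1 : δ ≤ 1 / 4 := by
    have := pow_le_one₀ (n := k) hp0.le hp1
    linarith
  have hcover : ∀ e : Finset (Fin n), e.card = k → e ∉ G →
      δ ≤ ∑ W : Finset (Fin n), (if e ⊆ prune G W then subsetWeight p W else 0) := by
    intro e he heG
    refine le_trans ?_ (sum_subsetWeight_prune hp0.le hp1 G e)
    have h := sum_pow_card_union_le hp0.le hG hdeg (by positivity) he heG
    rw [hpq] at h
    have h2 := one_add_inv_two_mul_pow_le (k := k) (by omega)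
    have h3 := mul_le_mul_of_nonneg_left h2 (pow_pos hp0 k).le
    rw [he]
    linarith
  set F : Finset (Finset (Fin n)) := (powersetCard k univ).filter (· ∉ G) with hF
  obtain ⟨I, hI, hIF⟩ := exists_iterated_cover (P := IsIndep G) (r := 1 - δ) (by linarith) F
    (fun F' hF' => by
      obtain ⟨W, hW⟩ := exists_prune_cover (δ := δ) hp0.le hp1 G F' fun e he => by
        have := hF' he
        simp only [hF, mem_filter, mem_powersetCard] at this
        exact hcover e this.1.2 this.2
      exact ⟨_, isIndep_prune hempty W, hW⟩) ⌊k * Real.log n / δ⌋₊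
  have hFcard : (F.card : ℝ) ≤ n.choose k := by
    have : F.card ≤ (powersetCard k (univ : Finset (Fin n))).card := card_filter_le _ _
    rw [card_powersetCard, card_fin] at this
    exact_mod_cast this
  have hlt := pow_floor_mul_choose_lt_one hn hk hδ0 hδ1
  have hzero : (F.filter fun e => ∀ j, ¬ e ⊆ I j).card = 0 := by
    have : ((F.filter fun e => ∀ j, ¬ e ⊆ I j).card : ℝ) < 1 :=
      (hIF.trans (mul_le_mul_of_nonneg_left hFcard (pow_nonneg (by linarith) _))).trans_lt hlt
    exact Nat.lt_one_iff.1 (by exact_mod_cast this)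
  have hle : vartheta k G ≤ ⌊k * Real.log n / δ⌋₊ := by
    refine Nat.sInf_le ⟨I, hI, fun e he heG => ?_⟩
    by_contra! hcon
    have hmem : e ∈ F.filter fun e => ∀ j, ¬ e ⊆ I j :=
      mem_filter.2 ⟨mem_filter.2 ⟨mem_powersetCard.2 ⟨subset_univ _, he⟩, heG⟩, hcon⟩
    rw [card_eq_zero.1 hzero] at hmem
    exact notMem_empty _ hmem
  have hlog : 0 ≤ Real.log n := Real.log_natCast_nonneg n
  calc (vartheta k G : ℝ) ≤ ⌊k * Real.log n / δ⌋₊ := by exact_mod_cast hle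
    _ ≤ k * Real.log n / δ := Nat.floor_le (by positivity)
    _ = _ := by
      rw [hqpow, hδ, hp, div_pow, mul_pow, mul_pow]
      field_simp
      ring
end

section
/- Let k ≥ 3 and let m ≥ m_0(k) be sufficiently large, and let d ≤ m. Fix disjoint vertex sets V_1,…,V_k each of size m, and let F^{(k)}_{m,d} be the family of k-graphs F on V_1 ∪ … ∪ V_k such that (i) every edge e ∈ F is transversal, i.e. |e ∩ V_i| = 1 for all 1 ≤ i ≤ k, (ii) F is linear, and (iii) Δ(F) ≤ d. Then |F^{(k)}_{m,d}| ≥ (m^{k-1}/d)^{md/(2k^2)}. -/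
open Finset

variable {V : Type*} [DecidableEq V]

/-- A set of functions `Fin k → Fin m`, regarded as transversal edges, such that any two of them
agree in at most one coordinate and at most `d` of them take a given value at a given coordinate. -/
def IsLinearFamily {k m : ℕ} (d : ℕ) (G : Finset (Fin k → Fin m)) : Prop :=
  (∀ g ∈ G, ∀ h ∈ G, g ≠ h → #{i | g i = h i} ≤ 1) ∧ ∀ i a, #{g ∈ G | g i = a} ≤ d

open Classical in
/-- The linear families with exactly `j` members. -/
noncomputable def linearFamilies (k m d j : ℕ) : Finset (Finset (Fin k → Fin m)) :=
  {G | IsLinearFamily d G ∧ #G = j}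

theorem empty_mem_linearFamilies (k m d : ℕ) : ∅ ∈ linearFamilies k m d 0 := by
  simp [linearFamilies, IsLinearFamily]

/-- The transversal edge given by a function: its graph. -/
def graphEdge {k m : ℕ} (f : Fin k → Fin m) : Finset (Fin k × Fin m) :=
  univ.image fun i => (i, f i)

theorem mem_graphEdge {k m : ℕ} {f : Fin k → Fin m} {x : Fin k × Fin m} :
    x ∈ graphEdge f ↔ f x.1 = x.2 := by
  simp only [graphEdge, mem_image, mem_univ, true_and]
  constructor
  · rintro ⟨i, rfl⟩
    rfl
  · intro h
    exact ⟨x.1, Prod.ext rfl h⟩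

theorem graphEdge_injective {k m : ℕ} :
    Function.Injective (graphEdge : (Fin k → Fin m) → Finset (Fin k × Fin m)) := by
  intro f g h
  funext i
  have : (i, f i) ∈ graphEdge g := h ▸ mem_graphEdge.2 rfl
  exact (mem_graphEdge.1 this).symm

theorem card_graphEdge_filter_fst {k m : ℕ} (f : Fin k → Fin m) (i : Fin k) :
    #{x ∈ graphEdge f | x.1 = i} = 1 := by
  rw [card_eq_one]
  refine ⟨(i, f i), ?_⟩
  ext ⟨a, b⟩
  simp only [mem_filter, mem_graphEdge, mem_singleton, Prod.mk.injEq]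
  grind

theorem card_graphEdge_inter {k m : ℕ} (f g : Fin k → Fin m) :
    #(graphEdge f ∩ graphEdge g) ≤ #{i | f i = g i} := by
  refine card_le_card_of_injOn Prod.fst ?_ ?_
  · intro x hx
    simp only [coe_inter, Set.mem_inter_iff, mem_coe, mem_graphEdge] at hx
    simp [hx.1, hx.2]
  · intro x hx y hy hxy
    simp only [coe_inter, Set.mem_inter_iff, mem_coe, mem_graphEdge] at hx hy
    exact Prod.ext hxy (by rw [← hx.1, ← hy.1, hxy])

theorem degS_image_graphEdge {k m : ℕ} (G : Finset (Fin k → Fin m)) (v : Fin k × Fin m) :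
    degS (G.image graphEdge) {v} = #{g ∈ G | g v.1 = v.2} := by
  rw [degS, filter_image, card_image_of_injective _ graphEdge_injective]
  simp [mem_graphEdge]

theorem card_linearFamilies_le_ncard (k m d j : ℕ) :
    #(linearFamilies k m d j) ≤
      {F : Finset (Finset (Fin k × Fin m)) |
        (∀ e ∈ F, ∀ i : Fin k, (e.filter fun x => x.1 = i).card = 1) ∧
        (∀ e ∈ F, ∀ f ∈ F, e ≠ f → (e ∩ f).card ≤ 1) ∧
        (∀ v : Fin k × Fin m, degS F {v} ≤ d)}.ncard := by
  rw [← Set.ncard_coe_finset]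
  refine Set.ncard_le_ncard_of_injOn (fun G => G.image graphEdge) ?_
    (image_injective graphEdge_injective).injOn (Set.toFinite _)
  intro G hG
  simp only [linearFamilies, coe_filter, mem_univ, true_and, Set.mem_ofPred_eq] at hG
  obtain ⟨⟨hlin, hdeg⟩, -⟩ := hG
  refine ⟨?_, ?_, ?_⟩
  · intro e he i
    obtain ⟨g, -, rfl⟩ := mem_image.1 he
    exact card_graphEdge_filter_fst g i
  · intro e he f hf hef
    obtain ⟨g, hg, rfl⟩ := mem_image.1 he
    obtain ⟨h, hh, rfl⟩ := mem_image.1 hf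
    exact (card_graphEdge_inter g h).trans (hlin g hg h hh fun hgh => hef (hgh ▸ rfl))
  · intro v
    rw [degS_image_graphEdge]
    exact hdeg _ _

theorem card_functions_agreeing_on {k m : ℕ} (S : Finset (Fin k)) (g : Fin k → Fin m) :
    #{f : Fin k → Fin m | ∀ i ∈ S, g i = f i} = m ^ (k - #S) := by
  have h : ({f : Fin k → Fin m | ∀ i ∈ S, g i = f i} : Finset _) =
      Fintype.piFinset fun i => if i ∈ S then {g i} else univ := by
    ext f
    simp only [mem_filter, mem_univ, true_and, Fintype.mem_piFinset]
    refine forall_congr' fun i => ?_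
    split_ifs with hi <;> simp [hi, eq_comm]
  rw [h, Fintype.card_piFinset]
  have h' : ∀ i, #(if i ∈ S then {g i} else (univ : Finset (Fin m))) = if i ∈ S then 1 else m := by
    intro i
    split_ifs <;> simp
  simp only [h', prod_ite, prod_const_one, one_mul, prod_const]
  congr 1
  rw [filter_not, filter_mem_eq_inter, univ_inter, card_sdiff_of_subset (subset_univ S)]
  simp

theorem card_functions_agreeing_twice_le {k m : ℕ} (G : Finset (Fin k → Fin m)) :
    #{f : Fin k → Fin m | ∃ g ∈ G, 2 ≤ #{i | g i = f i}} ≤ #G * (k.choose 2 * m ^ (k - 2)) := by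
  have hsub : ({f : Fin k → Fin m | ∃ g ∈ G, 2 ≤ #{i | g i = f i}} : Finset _) ⊆
      G.biUnion fun g => (powersetCard 2 univ).biUnion fun S => {f | ∀ i ∈ S, g i = f i} := by
    intro f hf
    simp only [mem_filter, mem_univ, true_and] at hf
    obtain ⟨g, hg, h2⟩ := hf
    obtain ⟨S, hS, hcard⟩ := exists_subset_card_eq h2
    simp only [mem_biUnion, mem_powersetCard, mem_filter, mem_univ, true_and]
    exact ⟨g, hg, S, ⟨subset_univ _, hcard⟩, fun i hi => by simpa using hS hi⟩
  refine (card_le_card hsub).trans (card_biUnion_le_card_mul _ _ _ fun g _ => ?_)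
  have hpairs : #(powersetCard 2 (univ : Finset (Fin k))) = k.choose 2 := by simp
  rw [← hpairs]
  refine card_biUnion_le_card_mul _ _ _ fun S hS => ?_
  rw [card_functions_agreeing_on, (mem_powersetCard.1 hS).2]

theorem card_saturated_mul_le {k m : ℕ} (d : ℕ) (G : Finset (Fin k → Fin m)) (i : Fin k) :
    #{a | d ≤ #{g ∈ G | g i = a}} * d ≤ #G := by
  rw [← smul_eq_mul]
  calc _ ≤ ∑ a with d ≤ #{g ∈ G | g i = a}, #{g ∈ G | g i = a} :=
        card_nsmul_le_sum _ _ _ fun a ha => (mem_filter.1 ha).2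
    _ ≤ ∑ a, #{g ∈ G | g i = a} := sum_le_sum_of_subset (filter_subset _ _)
    _ = #G := (card_eq_sum_card_fiberwise fun _ _ => mem_coe.2 (mem_univ _)).symm

theorem card_functions_through_saturated_mul_le {k m : ℕ} (d : ℕ) (G : Finset (Fin k → Fin m)) :
    #{f : Fin k → Fin m | ∃ i, d ≤ #{g ∈ G | g i = f i}} * d ≤ k * (#G * m ^ (k - 1)) := by
  have hsub : ({f : Fin k → Fin m | ∃ i, d ≤ #{g ∈ G | g i = f i}} : Finset _) ⊆
      univ.biUnion fun i => ({a | d ≤ #{g ∈ G | g i = a}} : Finset (Fin m)).biUnion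
        fun a => {f | f i = a} := by
    intro f hf
    simpa using hf
  have hfix : ∀ (i : Fin k) (a : Fin m), #{f : Fin k → Fin m | f i = a} ≤ m ^ (k - 1) := by
    intro i a
    have := card_functions_agreeing_on {i} fun _ : Fin k => a
    simp only [mem_singleton, forall_eq, card_singleton] at this
    simp only [← this, eq_comm, le_refl]
  calc _ ≤ (∑ i, #{a | d ≤ #{g ∈ G | g i = a}} * m ^ (k - 1)) * d := by
        refine Nat.mul_le_mul_right _ ((card_le_card hsub).trans (card_biUnion_le.trans ?_))
        exact sum_le_sum fun i _ => card_biUnion_le_card_mul _ _ _ fun a _ => hfix i a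
    _ = ∑ i, #{a | d ≤ #{g ∈ G | g i = a}} * d * m ^ (k - 1) := by
        rw [sum_mul]
        exact sum_congr rfl fun _ _ => by ring
    _ ≤ ∑ _i : Fin k, #G * m ^ (k - 1) :=
        sum_le_sum fun i _ => Nat.mul_le_mul_right _ (card_saturated_mul_le d G i)
    _ = k * (#G * m ^ (k - 1)) := by simp

/-- The functions which can be added to `G` while keeping it a linear family. -/
def extendingFunctions {k m : ℕ} (d : ℕ) (G : Finset (Fin k → Fin m)) :
    Finset (Fin k → Fin m) :=
  {f | (∀ g ∈ G, #{i | g i = f i} ≤ 1) ∧ ∀ i, #{g ∈ G | g i = f i} < d}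

theorem pow_le_three_mul_card_extendingFunctions {k m d : ℕ} (hk : 3 ≤ k) (hd : 0 < d)
    (hdm : d ≤ m) (G : Finset (Fin k → Fin m)) (hG : #G * k ^ 2 ≤ m * d) :
    m ^ k ≤ 3 * #(extendingFunctions d G) := by
  set A : Finset (Fin k → Fin m) := {f | ∃ g ∈ G, 2 ≤ #{i | g i = f i}} with hA
  set B : Finset (Fin k → Fin m) := {f | ∃ i, d ≤ #{g ∈ G | g i = f i}} with hB
  have htotal : m ^ k ≤ #A + #B + #(extendingFunctions d G) := by
    have hcover : (univ : Finset (Fin k → Fin m)) ⊆ A ∪ B ∪ extendingFunctions d G := by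
      intro f _
      simp only [hA, hB, extendingFunctions, mem_union, mem_filter, mem_univ, true_and]
      by_contra! h
      obtain ⟨⟨h1, h2⟩, h3⟩ := h
      obtain ⟨i, hi⟩ := h3 fun g hg => Nat.lt_succ_iff.1 (h1 g hg)
      exact absurd (h2 i) (not_lt.2 hi)
    calc m ^ k = #(univ : Finset (Fin k → Fin m)) := by simp
      _ ≤ #(A ∪ B ∪ extendingFunctions d G) := card_le_card hcover
      _ ≤ _ := (card_union_le _ _).trans (Nat.add_le_add_right (card_union_le _ _) _)
  have hpow1 : m ^ k = m * m ^ (k - 1) := (mul_pow_sub_one (by omega) m).symm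
  have hpow2 : m ^ k = m * m * m ^ (k - 2) := by
    rw [← pow_two, ← pow_add]
    congr 1
    omega
  have hAcard : 2 * k * #A ≤ (k - 1) * m ^ k := by
    have hchoose : 2 * k.choose 2 = k * (k - 1) := by
      rw [Nat.choose_two_right, Nat.mul_div_cancel' (Nat.even_mul_pred_self k).two_dvd]
    refine Nat.le_of_mul_le_mul_left (c := k) ?_ (by omega)
    calc k * (2 * k * #A) ≤ k * (2 * k * (#G * (k.choose 2 * m ^ (k - 2)))) := by
          gcongr
          exact card_functions_agreeing_twice_le G
      _ = #G * k ^ 2 * (2 * k.choose 2) * m ^ (k - 2) := by ring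
      _ ≤ m * m * (2 * k.choose 2) * m ^ (k - 2) := by
          gcongr ?_ * _ * _
          exact hG.trans (Nat.mul_le_mul_left _ hdm)
      _ = k * ((k - 1) * m ^ k) := by rw [hchoose, hpow2]; ring
  have hBcard : k * #B ≤ m ^ k := by
    refine Nat.le_of_mul_le_mul_left (c := k * d) ?_ (by positivity)
    calc k * d * (k * #B) = k ^ 2 * (#B * d) := by ring
      _ ≤ k ^ 2 * (k * (#G * m ^ (k - 1))) :=
          Nat.mul_le_mul_left _ (card_functions_through_saturated_mul_le d G)
      _ = k * (#G * k ^ 2) * m ^ (k - 1) := by ring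
      _ ≤ k * (m * d) * m ^ (k - 1) := by gcongr
      _ = k * d * m ^ k := by rw [hpow1]; ring
  obtain ⟨l, rfl⟩ : ∃ l, k = l + 3 := ⟨k - 3, by omega⟩
  simp only [Nat.add_succ_sub_one] at hAcard
  nlinarith

theorem isLinearFamily_insert {k m d : ℕ} {G : Finset (Fin k → Fin m)} (hG : IsLinearFamily d G)
    {f : Fin k → Fin m} (hf : f ∈ extendingFunctions d G) : IsLinearFamily d (insert f G) := by
  simp only [extendingFunctions, mem_filter, mem_univ, true_and] at hf
  refine ⟨?_, ?_⟩
  · intro g hg h hh hgh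
    rcases mem_insert.1 hg with rfl | hg' <;> rcases mem_insert.1 hh with rfl | hh'
    · exact absurd rfl hgh
    · simpa only [eq_comm] using hf.1 h hh'
    · exact hf.1 g hg'
    · exact hG.1 g hg' h hh' hgh
  · intro i a
    rw [filter_insert]
    split_ifs with h
    · subst h
      exact (card_insert_le _ _).trans (hf.2 i)
    · exact hG.2 i a

theorem notMem_of_mem_extendingFunctions {k m d : ℕ} (hk : 2 ≤ k) {G : Finset (Fin k → Fin m)}
    {f : Fin k → Fin m} (hf : f ∈ extendingFunctions d G) : f ∉ G := by
  intro hfG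
  simp only [extendingFunctions, mem_filter, mem_univ, true_and] at hf
  have := hf.1 f hfG
  simp only [filter_true, card_univ, Fintype.card_fin] at this
  omega

theorem card_linearFamilies_succ {k m d j : ℕ} (hk : 3 ≤ k) (hd : 0 < d) (hdm : d ≤ m)
    (hj : j * k ^ 2 ≤ m * d) :
    #(linearFamilies k m d j) * m ^ k ≤ #(linearFamilies k m d (j + 1)) * (3 * (j + 1)) := by
  classical
  have hext : ∀ G ∈ linearFamilies k m d j, (m ^ k + 2) / 3 ≤
      #(bipartiteAbove (· ⊆ ·) (linearFamilies k m d (j + 1)) G) := by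
    intro G hG
    obtain ⟨hlin, rfl⟩ := (mem_filter.1 hG).2
    have hcard := pow_le_three_mul_card_extendingFunctions hk hd hdm G hj
    have hle : #(extendingFunctions d G) ≤
        #(bipartiteAbove (· ⊆ ·) (linearFamilies k m d (#G + 1)) G) := by
      refine card_le_card_of_injOn (fun f => insert f G) ?_ ?_
      · intro f hf
        have hfG := notMem_of_mem_extendingFunctions (by omega) hf
        simp only [bipartiteAbove, linearFamilies, coe_filter, mem_filter, mem_univ, true_and]
        exact ⟨⟨isLinearFamily_insert hlin hf, card_insert_of_notMem hfG⟩, subset_insert _ _⟩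
      · intro f hf g hg hfg
        have hfG := notMem_of_mem_extendingFunctions (by omega) hf
        have : f ∈ insert g G := hfg.subset (mem_insert_self f G)
        exact (mem_insert.1 this).resolve_right hfG
    omega
  have hsub : ∀ H ∈ linearFamilies k m d (j + 1),
      #(bipartiteBelow (· ⊆ ·) (linearFamilies k m d j) H) ≤ j + 1 := by
    intro H hH
    have hHcard : #H = j + 1 := (mem_filter.1 hH).2.2
    have hpow : #(powersetCard j H) = j + 1 := by simp [card_powersetCard, hHcard]
    rw [← hpow]
    refine card_le_card fun G hG => ?_
    simp only [bipartiteBelow, linearFamilies, mem_filter, mem_univ, true_and] at hG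
    exact mem_powersetCard.2 ⟨hG.2, hG.1.2⟩
  have := card_mul_le_card_mul (fun G H : Finset (Fin k → Fin m) => G ⊆ H) hext hsub
  calc #(linearFamilies k m d j) * m ^ k
      ≤ #(linearFamilies k m d j) * (3 * ((m ^ k + 2) / 3)) := by
        gcongr
        omega
    _ = 3 * (#(linearFamilies k m d j) * ((m ^ k + 2) / 3)) := by ring
    _ ≤ 3 * (#(linearFamilies k m d (j + 1)) * (j + 1)) := by gcongr
    _ = _ := by ring

theorem pow_pow_le_card_linearFamilies_mul {k m d : ℕ} (hk : 3 ≤ k) (hd : 0 < d) (hdm : d ≤ m)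
    (j : ℕ) (hj : j * k ^ 2 ≤ m * d) :
    (m ^ k) ^ j ≤ #(linearFamilies k m d j) * (3 ^ j * j.factorial) := by
  induction j with
  | zero =>
    simpa using card_pos.2 ⟨∅, empty_mem_linearFamilies k m d⟩
  | succ j ih =>
    have hj' : j * k ^ 2 ≤ m * d := (Nat.mul_le_mul_right _ j.le_succ).trans hj
    calc (m ^ k) ^ (j + 1) = (m ^ k) ^ j * m ^ k := pow_succ _ _
      _ ≤ #(linearFamilies k m d j) * (3 ^ j * j.factorial) * m ^ k := by
          gcongr
          exact ih hj'
      _ = #(linearFamilies k m d j) * m ^ k * (3 ^ j * j.factorial) := by ring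
      _ ≤ #(linearFamilies k m d (j + 1)) * (3 * (j + 1)) * (3 ^ j * j.factorial) := by
          exact Nat.mul_le_mul_right _ (card_linearFamilies_succ hk hd hdm hj')
      _ = _ := by
          rw [Nat.factorial_succ]
          ring

theorem pow_le_card_linearFamilies {k m d : ℕ} (hk : 3 ≤ k) (hd : 0 < d) (hdm : d ≤ m)
    (j : ℕ) (hj : j * k ^ 2 ≤ m * d) :
    ((m : ℝ) ^ (k - 1) / d) ^ j ≤ #(linearFamilies k m d j) := by
  have hm : 0 < m := hd.trans_le hdm
  have hfact : 3 ^ j * j.factorial ≤ (m * d) ^ j := by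
    calc 3 ^ j * j.factorial ≤ 3 ^ j * j ^ j := by
          gcongr
          exact Nat.factorial_le_pow j
      _ = (j * 3) ^ j := by rw [mul_comm j 3, mul_pow]
      _ ≤ (m * d) ^ j := by
          refine Nat.pow_le_pow_left (le_trans ?_ hj) j
          gcongr
          nlinarith
  have hmain : (m ^ k) ^ j ≤ #(linearFamilies k m d j) * (m * d) ^ j :=
    (pow_pow_le_card_linearFamilies_mul hk hd hdm j hj).trans (Nat.mul_le_mul_left _ hfact)
  have hbase : (m : ℝ) ^ (k - 1) / d = (m : ℝ) ^ k / (m * d) := by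
    rw [← mul_pow_sub_one (by omega : k ≠ 0) (m : ℝ)]
    field_simp
  rw [hbase, div_pow, div_le_iff₀ (by positivity)]
  exact_mod_cast hmain

/-- For `k ≥ 3` and `m` sufficiently large, `d ≤ m`: the family of `k`-partite `k`-graphs `F`
on `V_1 ∪ … ∪ V_k` (each part of size `m`, modelled as `Fin k × Fin m` with
`V_i = {i} × Fin m`) whose edges are transversal, which are linear, and with `Δ(F) ≤ d`,
has at least `(m^{k-1}/d)^{md/(2k²)}` members. -/
theorem size_of_partite_family (k : ℕ) (hk : 3 ≤ k) :
    ∃ m₀ : ℕ, ∀ m : ℕ, m₀ ≤ m → ∀ d : ℕ, d ≤ m →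
      ((m : ℝ) ^ (k - 1) / (d : ℝ)) ^ ((m * d : ℝ) / (2 * (k : ℝ) ^ 2)) ≤
        ({F : Finset (Finset (Fin k × Fin m)) |
            (∀ e ∈ F, ∀ i : Fin k, (e.filter fun x => x.1 = i).card = 1) ∧
            (∀ e ∈ F, ∀ f ∈ F, e ≠ f → (e ∩ f).card ≤ 1) ∧
            (∀ v : Fin k × Fin m, degS F {v} ≤ d)}.ncard : ℝ) := by
  refine ⟨k ^ 2, fun m hm d hdm => ?_⟩
  rcases Nat.eq_zero_or_pos d with rfl | hd
  · have hone : 1 ≤ #(linearFamilies k m 0 0) :=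
      card_pos.2 ⟨∅, empty_mem_linearFamilies k m 0⟩
    simpa using hone.trans (card_linearFamilies_le_ncard k m 0 0)
  · have hm0 : 0 < m := hd.trans_le hdm
    have hk0 : 0 < k ^ 2 := by positivity
    set t := m * d / k ^ 2 with ht
    have ht1 : 1 ≤ t := (Nat.one_le_div_iff hk0).2 (hm.trans (Nat.le_mul_of_pos_right m hd))
    have hlt : m * d < (t + 1) * k ^ 2 := by
      simpa [mul_comm] using Nat.lt_mul_div_succ (m * d) hk0
    have hexp : (m * d : ℝ) / (2 * (k : ℝ) ^ 2) ≤ t := by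
      rw [div_le_iff₀ (by positivity)]
      have : m * d ≤ t * (2 * k ^ 2) := by nlinarith
      exact_mod_cast this
    have hbase : 1 ≤ (m : ℝ) ^ (k - 1) / d := by
      rw [one_le_div (by positivity)]
      have : d ≤ m ^ (k - 1) := hdm.trans (Nat.le_self_pow (by omega) m)
      exact_mod_cast this
    calc _ ≤ ((m : ℝ) ^ (k - 1) / d) ^ (t : ℝ) := Real.rpow_le_rpow_of_exponent_le hbase hexp
      _ = ((m : ℝ) ^ (k - 1) / d) ^ t := Real.rpow_natCast _ _
      _ ≤ #(linearFamilies k m d t) :=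
        pow_le_card_linearFamilies hk hd hdm t (Nat.div_mul_le_self _ _)
      _ ≤ _ := by exact_mod_cast card_linearFamilies_le_ncard k m d t
end

section
/- Let k = 2ℓ be even with ℓ ≥ 1, let F be a 2-graph (graph) on vertex set [N], and let G be the k-graph on vertex set [N] × [ℓ] whose edges are exactly the sets V_i ∪ V_j for {i,j} ∈ F, where V_i = {i} × [ℓ]. Then Δ(G) = Δ(F) and ϑ(G) ≥ ϑ(F). -/
open Finset

variable {V : Type*} [DecidableEq V]

theorem vartheta_le_of_witness {α : Type*} {k t : ℕ} {G : Finset (Finset α)} (I : Fin t → Finset α)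
    (hI : ∀ j, IsIndep G (I j))
    (hcov : ∀ e : Finset α, e.card = k → e ∉ G → ∃ j, e ⊆ I j) : vartheta k G ≤ t :=
  Nat.sInf_le ⟨I, hI, hcov⟩

/-- In a `k`-uniform hypergraph the non-edges themselves form a finite cover by independent
sets, so the minimum defining `vartheta` is attained. -/
theorem exists_vartheta_witness [Fintype V] {k : ℕ} {G : Finset (Finset V)}
    (hG : ∀ e ∈ G, e.card = k) :
    ∃ I : Fin (vartheta k G) → Finset V, (∀ j, IsIndep G (I j)) ∧
      ∀ e : Finset V, e.card = k → e ∉ G → ∃ j, e ⊆ I j := by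
  refine Nat.sInf_mem (s := {t | ∃ I : Fin t → Finset V, (∀ j, IsIndep G (I j)) ∧
      ∀ e : Finset V, e.card = k → e ∉ G → ∃ j, e ⊆ I j}) ?_
  let S : Finset (Finset V) := univ.filter fun e => e.card = k ∧ e ∉ G
  refine ⟨S.card, fun j => (S.equivFin.symm j : Finset V), fun j e he hsub => ?_,
    fun e hk he => ?_⟩
  · have hS := (S.equivFin.symm j).2
    simp only [S, mem_filter, mem_univ, true_and] at hS
    have heq : e = S.equivFin.symm j := eq_of_subset_of_card_le hsub (by rw [hS.1, hG e he])
    exact hS.2 (by rwa [heq] at he)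
  · have hS : e ∈ S := by simp [S, hk, he]
    exact ⟨S.equivFin ⟨e, hS⟩, by simp⟩

theorem product_univ_injective {α W : Type*} [Fintype W] [Nonempty W] :
    Function.Injective fun e : Finset α => e ×ˢ (univ : Finset W) := by
  intro e f h
  ext x
  obtain ⟨w⟩ := ‹Nonempty W›
  simpa using congrArg (fun s : Finset (α × W) => (x, w) ∈ s) h

theorem degS_image_product_univ {W : Type*} [Fintype W] [DecidableEq W] [Nonempty W]
    (F : Finset (Finset V)) (v : V × W) :
    degS (F.image fun e => e ×ˢ (univ : Finset W)) {v} = degS F {v.1} := by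
  unfold degS
  rw [filter_image, card_image_of_injective _ product_univ_injective]
  simp

/-- Let `k = 2ℓ` with `ℓ ≥ 1`, `F` a graph on `[N]`, and `G` the `k`-graph on `[N] × [ℓ]`
whose edges are exactly the sets `V_i ∪ V_j` for `{i,j} ∈ F`, where `V_i = {i} × [ℓ]`.
Then `Δ(G) = Δ(F)` and `ϑ(G) ≥ ϑ(F)`. -/
theorem blowup_theta (l N : ℕ) (hl : 1 ≤ l)
    (F : Finset (Finset (Fin N))) (hF : ∀ e ∈ F, e.card = 2)
    (G : Finset (Finset (Fin N × Fin l)))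
    (hG : ∀ e : Finset (Fin N × Fin l),
      e ∈ G ↔ ∃ i j : Fin N, ({i, j} : Finset (Fin N)) ∈ F ∧
        e = ({i} : Finset (Fin N)) ×ˢ (univ : Finset (Fin l)) ∪
            ({j} : Finset (Fin N)) ×ˢ (univ : Finset (Fin l))) :
    (univ.sup fun v : Fin N × Fin l => degS G {v}) = (univ.sup fun v : Fin N => degS F {v}) ∧
    vartheta 2 F ≤ vartheta (2 * l) G := by
  have : Nonempty (Fin l) := ⟨⟨0, hl⟩⟩
  have hGF : G = F.image fun e => e ×ˢ (univ : Finset (Fin l)) := by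
    ext e
    rw [hG, mem_image]
    constructor
    · rintro ⟨i, j, hij, rfl⟩
      exact ⟨_, hij, by rw [← union_product, insert_eq]⟩
    · rintro ⟨f, hf, rfl⟩
      obtain ⟨i, j, -, rfl⟩ := card_eq_two.1 (hF f hf)
      exact ⟨i, j, hf, by rw [← union_product, insert_eq]⟩
  subst hGF
  refine ⟨?_, ?_⟩
  · simp only [degS_image_product_univ]
    apply le_antisymm
    · exact Finset.sup_le fun v _ => le_sup (f := fun v : Fin N => degS F {v}) (mem_univ v.1)
    · exact Finset.sup_le fun v _ =>
        le_sup (f := fun v : Fin N × Fin l => degS F {v.1}) (mem_univ (v, ⟨0, hl⟩))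
  · obtain ⟨I, hI, hcov⟩ := exists_vartheta_witness (k := 2 * l)
      (G := F.image fun e => e ×ˢ (univ : Finset (Fin l))) (by
        intro e he
        obtain ⟨f, hf, rfl⟩ := mem_image.1 he
        simp [card_product, hF f hf])
    refine vartheta_le_of_witness
      (fun j => univ.filter fun i : Fin N => ∀ w : Fin l, (i, w) ∈ I j) ?_ ?_
    · intro j e he hsub
      refine hI j _ (mem_image_of_mem _ he) fun x hx => ?_
      exact (mem_filter.1 (hsub (mem_product.1 hx).1)).2 x.2
    · intro e hk he
      obtain ⟨j, hj⟩ := hcov (e ×ˢ univ) (by simp [card_product, hk])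
        (by rwa [product_univ_injective.mem_finset_image])
      exact ⟨j, fun i hi => mem_filter.2 ⟨mem_univ _, fun w => hj (by simp [hi])⟩⟩
end

section
/- For every k ≥ 3 there exists a positive constant c_2 depending only on k such that every partial Steiner (n,k,2)-system S satisfies ϑ(S) ≤ c_2 · n^{k/(k-1)} · log n. -/
open Finset

variable {V : Type*} [DecidableEq V]

/-- `S` is a partial Steiner `(n,k,2)`-system: a `k`-graph in which every pair of distinct
vertices lies in at most one edge. -/
def IsPartialSteiner (k : ℕ) (S : Finset (Finset V)) : Prop :=
  (∀ e ∈ S, e.card = k) ∧ ∀ x y : V, x ≠ y → degS S {x, y} ≤ 1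

/-- If every target in `F` is hit by at least a `1 / Q` proportion of `α`, then `t` elements of `α`
suffice to hit all of `F`, provided `t` is large compared with `Q * log #F`. -/
theorem exists_tuple_covering {α β : Type*} [Fintype α] [Nonempty α] [DecidableEq β]
    (r : α → β → Prop) [∀ a b, Decidable (r a b)] (F : Finset β) (Q : ℝ) (hQ : 1 ≤ Q) (t : ℕ)
    (hr : ∀ b ∈ F, (Fintype.card α : ℝ) ≤ (univ.filter fun a => r a b).card * Q)
    (ht : (F.card : ℝ) * Real.exp (-(t / Q)) < 1) :
    ∃ a : Fin t → α, ∀ b ∈ F, ∃ j, r (a j) b := by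
  classical
  have hQ0 : 0 < Q := by linarith
  set N : ℝ := (Fintype.card α : ℝ) with hN
  have hN0 : 0 < N := Nat.cast_pos.2 Fintype.card_pos
  by_contra! hcon
  have hcover : (univ : Finset (Fin t → α)) ⊆
      F.biUnion fun b => Fintype.piFinset fun _ : Fin t => univ.filter fun a => ¬ r a b := by
    intro a _
    obtain ⟨b, hb, h⟩ := hcon a
    simp only [mem_biUnion, Fintype.mem_piFinset, mem_filter, mem_univ, true_and]
    exact ⟨b, hb, h⟩
  have hmiss : ∀ b ∈ F,
      ((Fintype.piFinset fun _ : Fin t => univ.filter fun a => ¬ r a b).card : ℝ)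
        ≤ N ^ t * Real.exp (-(t / Q)) := by
    intro b hb
    have hsplit := card_filter_add_card_filter_not (s := (univ : Finset α)) (fun a => r a b)
    have hsplit' : ((univ.filter fun a => r a b).card : ℝ)
        + (univ.filter fun a => ¬ r a b).card = N := by
      rw [hN, ← card_univ]; exact_mod_cast hsplit
    have hone : ((univ.filter fun a => ¬ r a b).card : ℝ) ≤ N * Real.exp (-(1 / Q)) := by
      have h1 : N / Q ≤ ((univ.filter fun a => r a b).card : ℝ) := by
        rw [div_le_iff₀ hQ0]; exact hr b hb
      have h2 := Real.add_one_le_exp (-(1 / Q))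
      have h3 : N * (-(1 / Q) + 1) ≤ N * Real.exp (-(1 / Q)) := by gcongr
      have h4 : N * (-(1 / Q) + 1) = N - N / Q := by ring
      linarith
    have hexp : Real.exp (-(t / Q)) = Real.exp (-(1 / Q)) ^ t := by
      rw [← Real.exp_nat_mul]; congr 1; ring
    rw [Fintype.card_piFinset_const, hexp, ← mul_pow]
    push_cast
    gcongr
  have hcard : N ^ t ≤ F.card * (N ^ t * Real.exp (-(t / Q))) := by
    have h1 : ((univ : Finset (Fin t → α)).card : ℝ) ≤ ∑ b ∈ F,
        ((Fintype.piFinset fun _ : Fin t => univ.filter fun a => ¬ r a b).card : ℝ) := by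
      exact_mod_cast (card_le_card hcover).trans card_biUnion_le
    have h2 : ((univ : Finset (Fin t → α)).card : ℝ) = N ^ t := by simp [hN]
    rw [← h2]
    refine h1.trans ((sum_le_sum hmiss).trans ?_)
    rw [sum_const, nsmul_eq_mul, h2]
  have hpos : 0 < N ^ t := by positivity
  nlinarith

/-- The colorings with `m` colors that vanish on `A`. -/
def zeroOn {W : Type*} [DecidableEq W] [Fintype W] (m : ℕ) [NeZero m] (A : Finset W) :
    Finset (W → Fin m) :=
  univ.filter fun χ => ∀ v ∈ A, χ v = 0

theorem card_zeroOn_mul_pow {W : Type*} [DecidableEq W] [Fintype W] (m : ℕ) [NeZero m]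
    (A : Finset W) : (zeroOn m A).card * m ^ A.card = m ^ Fintype.card W := by
  have h : zeroOn m A = Fintype.piFinset fun v => if v ∈ A then {0} else univ := by
    ext χ
    simp only [zeroOn, mem_filter, mem_univ, true_and, Fintype.mem_piFinset]
    refine forall_congr' fun v => ?_
    split_ifs with hv <;> simp [hv]
  have hprod : ∀ v, (if v ∈ A then ({0} : Finset (Fin m)) else univ).card
      = if v ∈ A then 1 else m := by
    intro v; split_ifs <;> simp
  rw [h, Fintype.card_piFinset, prod_congr rfl fun v _ => hprod v, prod_ite]
  simp only [prod_const, one_pow, one_mul]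
  rw [← pow_add, ← card_univ, ← card_filter_add_card_filter_not (s := univ) (fun v => v ∈ A),
    add_comm]
  simp

/-- The vertices of color `0` lying in no edge of `S` whose vertices all have color `0`. -/
def isolatedZeros {n m : ℕ} [NeZero m] (S : Finset (Finset (Fin n))) (χ : Fin n → Fin m) :
    Finset (Fin n) :=
  univ.filter fun v => χ v = 0 ∧ ∀ f ∈ S, v ∈ f → ¬ ∀ u ∈ f, χ u = 0

theorem isIndep_isolatedZeros {n m k : ℕ} [NeZero m] (hk : 0 < k)
    {S : Finset (Finset (Fin n))} (hS : ∀ e ∈ S, e.card = k) (χ : Fin n → Fin m) :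
    IsIndep S (isolatedZeros S χ) := by
  intro f hf hsub
  have hzero : ∀ v ∈ f, χ v = 0 ∧ ∀ f ∈ S, v ∈ f → ¬ ∀ u ∈ f, χ u = 0 := by
    intro v hv
    simpa [isolatedZeros] using hsub hv
  obtain ⟨v, hv⟩ := card_pos.1 (by rw [hS f hf]; exact hk)
  exact (hzero v hv).2 f hf hv fun u hu => (hzero u hu).1

theorem IsPartialSteiner.eq_of_mem {n k : ℕ} {S : Finset (Finset (Fin n))}
    (hS : IsPartialSteiner k S) {x y : Fin n} (hxy : x ≠ y) {f g : Finset (Fin n)}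
    (hf : f ∈ S) (hg : g ∈ S) (hxf : x ∈ f) (hyf : y ∈ f) (hxg : x ∈ g) (hyg : y ∈ g) :
    f = g :=
  card_le_one.1 (hS.2 x y hxy) f (by simp [hf, insert_subset_iff, hxf, hyf])
    g (by simp [hg, insert_subset_iff, hxg, hyg])

theorem IsPartialSteiner.card_filter_mem_le {n k : ℕ} (hk : 2 ≤ k)
    {S : Finset (Finset (Fin n))} (hS : IsPartialSteiner k S) (v : Fin n) :
    (S.filter fun f => v ∈ f).card ≤ n := by
  have hex : ∀ f ∈ S, v ∈ f → ∃ u ∈ f, u ≠ v := fun f hf _ =>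
    exists_mem_ne (by rw [hS.1 f hf]; omega) v
  have : Nonempty (Fin n) := ⟨v⟩
  choose! g hg using hex
  have h := card_le_card_of_injOn (s := S.filter fun f => v ∈ f) (t := univ) g
    (fun _ _ => by simp) (by
      intro a ha b hb hab
      rw [mem_coe, mem_filter] at ha hb
      have h1 := hg a ha.1 ha.2
      have h2 := hg b hb.1 hb.2
      exact hS.eq_of_mem h1.2 ha.1 hb.1 h1.1 ha.2 (hab ▸ h2.1) hb.2)
  simpa using h

/-- A non-edge is contained in `isolatedZeros S χ` for at least a `1 / (2 * m ^ k)` proportion of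
the colorings `χ`. -/
theorem IsPartialSteiner.card_subset_isolatedZeros {n k m : ℕ} [NeZero m] (hk : 2 ≤ k)
    {S : Finset (Finset (Fin n))} (hS : IsPartialSteiner k S)
    (hm : 4 * k ^ 2 ≤ m) (hmn : 4 * k * n ≤ m ^ (k - 1))
    {e : Finset (Fin n)} (he : e.card = k) (heS : e ∉ S) :
    m ^ n ≤ (univ.filter fun χ : Fin n → Fin m => e ⊆ isolatedZeros S χ).card
      * (2 * m ^ k) := by
  set G := univ.filter fun χ : Fin n → Fin m => e ⊆ isolatedZeros S χ with hG
  set S₁ := S.filter fun f => (e ∩ f).card = 1 with hS₁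
  set S₂ := S.filter fun f => 2 ≤ (e ∩ f).card with hS₂
  have hm0 : 0 < m := Nat.pos_of_ne_zero (NeZero.ne m)
  have hcover : zeroOn m e ⊆ G ∪ (S₁.biUnion (fun f => zeroOn m (e ∪ f))
      ∪ S₂.biUnion (fun f => zeroOn m (e ∪ f))) := by
    intro χ hχ
    by_cases hχG : χ ∈ G
    · exact mem_union_left _ hχG
    refine mem_union_right _ ?_
    simp only [zeroOn, mem_filter, mem_univ, true_and] at hχ
    have hbad : ∃ v ∈ e, ∃ f ∈ S, v ∈ f ∧ ∀ u ∈ f, χ u = 0 := by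
      by_contra! hno
      refine hχG ?_
      simp only [hG, mem_filter, mem_univ, true_and]
      intro v hv
      simp only [isolatedZeros, mem_filter, mem_univ, true_and]
      refine ⟨hχ v hv, fun f hf hvf hall => ?_⟩
      obtain ⟨u, hu, hne⟩ := hno v hv f hf hvf
      exact hne (hall u hu)
    obtain ⟨v, hv, f, hf, hvf, hall⟩ := hbad
    have hχf : χ ∈ zeroOn m (e ∪ f) := by
      simp only [zeroOn, mem_filter, mem_univ, true_and, mem_union]
      rintro u (hu | hu)
      exacts [hχ u hu, hall u hu]
    have hpos : 0 < (e ∩ f).card := card_pos.2 ⟨v, mem_inter.2 ⟨hv, hvf⟩⟩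
    simp only [mem_union, mem_biUnion, hS₁, hS₂, mem_filter]
    rcases Nat.lt_or_ge (e ∩ f).card 2 with h | h
    · exact Or.inl ⟨f, ⟨hf, by omega⟩, hχf⟩
    · exact Or.inr ⟨f, ⟨hf, h⟩, hχf⟩
  have hcS₁ : S₁.card ≤ k * n := by
    have hsub : S₁ ⊆ e.biUnion fun v => S.filter fun f => v ∈ f := by
      intro f hf
      simp only [hS₁, mem_filter] at hf
      obtain ⟨v, hv⟩ := card_pos.1 (by rw [hf.2]; exact one_pos)
      simp only [mem_biUnion, mem_filter]
      exact ⟨v, (mem_inter.1 hv).1, hf.1, (mem_inter.1 hv).2⟩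
    have h := (card_le_card hsub).trans
      (card_biUnion_le_card_mul _ _ n fun v _ => hS.card_filter_mem_le hk v)
    rwa [he] at h
  have hcS₂ : S₂.card ≤ k ^ 2 := by
    have hsub : S₂ ⊆ e.offDiag.biUnion fun p => S.filter fun f => {p.1, p.2} ⊆ f := by
      intro f hf
      simp only [hS₂, mem_filter] at hf
      obtain ⟨x, y, hx, hy, hxy⟩ := one_lt_card_iff.1 hf.2
      simp only [mem_biUnion, mem_filter, mem_offDiag]
      rw [mem_inter] at hx hy
      exact ⟨(x, y), ⟨hx.1, hy.1, hxy⟩, hf.1, by simp [insert_subset_iff, hx.2, hy.2]⟩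
    have h := (card_le_card hsub).trans
      (card_biUnion_le_card_mul _ _ 1 fun p hp => hS.2 p.1 p.2 (mem_offDiag.1 hp).2.2)
    rw [offDiag_card, he] at h
    have : k * k = k ^ 2 := by ring
    omega
  set Z := (zeroOn m e).card with hZ
  have hZe : Z * m ^ k = m ^ n := by
    have h := card_zeroOn_mul_pow m e
    rwa [he, Fintype.card_fin] at h
  have hunion : ∀ j, ∀ f, e.card + j ≤ (e ∪ f).card → (zeroOn m (e ∪ f)).card * m ^ j ≤ Z := by
    intro j f hj
    have h := card_zeroOn_mul_pow m (e ∪ f)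
    rw [Fintype.card_fin, ← hZe] at h
    refine Nat.le_of_mul_le_mul_right ?_ (pow_pos hm0 k)
    rw [← h, mul_assoc, ← pow_add]
    exact Nat.mul_le_mul_left _ (Nat.pow_le_pow_right hm0 (by omega))
  have hcu : ∀ f ∈ S, (e ∪ f).card + (e ∩ f).card = k + k := by
    intro f hf
    rw [card_union_add_card_inter, he, hS.1 f hf]
  have hB₁ : 4 * (S₁.biUnion fun f => zeroOn m (e ∪ f)).card ≤ Z := by
    rcases S₁.eq_empty_or_nonempty with h0 | ⟨f₀, _⟩
    · simp [h0]
    have hle : ∀ f ∈ S₁, 4 * k * n * (zeroOn m (e ∪ f)).card ≤ Z := by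
      intro f hf
      simp only [hS₁, mem_filter] at hf
      have h1 := hcu f hf.1
      have h2 := hunion (k - 1) f (by omega)
      calc 4 * k * n * (zeroOn m (e ∪ f)).card ≤ m ^ (k - 1) * (zeroOn m (e ∪ f)).card := by gcongr
        _ ≤ Z := by rwa [mul_comm]
    have hsum : 4 * k * n * (S₁.biUnion fun f => zeroOn m (e ∪ f)).card ≤ k * n * Z := by
      calc _ ≤ 4 * k * n * ∑ f ∈ S₁, (zeroOn m (e ∪ f)).card := by
            gcongr; exact card_biUnion_le
        _ = ∑ f ∈ S₁, 4 * k * n * (zeroOn m (e ∪ f)).card := by rw [mul_sum]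
        _ ≤ S₁.card * Z := by simpa using sum_le_card_nsmul _ _ _ hle
        _ ≤ k * n * Z := by gcongr
    have hn : 0 < n := by
      have := card_le_univ e
      rw [Fintype.card_fin] at this
      omega
    have hkn : 0 < k * n := Nat.mul_pos (by omega) hn
    refine Nat.le_of_mul_le_mul_left ?_ hkn
    calc _ = 4 * k * n * (S₁.biUnion fun f => zeroOn m (e ∪ f)).card := by ring
      _ ≤ _ := hsum
  have hB₂ : 4 * (S₂.biUnion fun f => zeroOn m (e ∪ f)).card ≤ Z := by
    have hle : ∀ f ∈ S₂, 4 * k ^ 2 * (zeroOn m (e ∪ f)).card ≤ Z := by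
      intro f hf
      simp only [hS₂, mem_filter] at hf
      have hlt : e.card < (e ∪ f).card := by
        refine card_lt_card (Finset.ssubset_iff_subset_ne.2 ⟨subset_union_left, fun heq => heS ?_⟩)
        have hfe : f ⊆ e := by rw [heq]; exact subset_union_right
        rw [← eq_of_subset_of_card_le hfe (by rw [he, hS.1 f hf.1])]
        exact hf.1
      have h2 := hunion 1 f hlt
      calc 4 * k ^ 2 * (zeroOn m (e ∪ f)).card ≤ m * (zeroOn m (e ∪ f)).card := by gcongr
        _ ≤ Z := by rwa [pow_one, mul_comm] at h2
    have hsum : 4 * k ^ 2 * (S₂.biUnion fun f => zeroOn m (e ∪ f)).card ≤ k ^ 2 * Z := by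
      calc _ ≤ 4 * k ^ 2 * ∑ f ∈ S₂, (zeroOn m (e ∪ f)).card := by
            gcongr; exact card_biUnion_le
        _ = ∑ f ∈ S₂, 4 * k ^ 2 * (zeroOn m (e ∪ f)).card := by rw [mul_sum]
        _ ≤ S₂.card * Z := by simpa using sum_le_card_nsmul _ _ _ hle
        _ ≤ k ^ 2 * Z := by gcongr
    have hk2 : 0 < k ^ 2 := by positivity
    refine Nat.le_of_mul_le_mul_left ?_ hk2
    calc _ = 4 * k ^ 2 * (S₂.biUnion fun f => zeroOn m (e ∪ f)).card := by ring
      _ ≤ _ := hsum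
  have hZG : Z ≤ G.card * 2 := by
    have h1 := card_le_card hcover
    have h2 := card_union_le G (S₁.biUnion (fun f => zeroOn m (e ∪ f))
      ∪ S₂.biUnion (fun f => zeroOn m (e ∪ f)))
    have h3 := card_union_le (S₁.biUnion (fun f => zeroOn m (e ∪ f)))
      (S₂.biUnion (fun f => zeroOn m (e ∪ f)))
    omega
  calc m ^ n = Z * m ^ k := hZe.symm
    _ ≤ G.card * 2 * m ^ k := by gcongr
    _ = G.card * (2 * m ^ k) := by ring

theorem IsPartialSteiner.vartheta_le {n k m t : ℕ} [NeZero m] (hk : 2 ≤ k)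
    {S : Finset (Finset (Fin n))} (hS : IsPartialSteiner k S)
    (hm : 4 * k ^ 2 ≤ m) (hmn : 4 * k * n ≤ m ^ (k - 1))
    (ht : (n : ℝ) ^ k * Real.exp (-(t / (2 * (m : ℝ) ^ k))) < 1) :
    vartheta k S ≤ t := by
  classical
  have hm1 : (1 : ℝ) ≤ m := by exact_mod_cast Nat.pos_of_ne_zero (NeZero.ne m)
  have hpow : (1 : ℝ) ≤ (m : ℝ) ^ k := one_le_pow₀ hm1
  set F := (univ.powersetCard k).filter fun e : Finset (Fin n) => e ∉ S with hF
  have hcF : (F.card : ℝ) ≤ (n : ℝ) ^ k := by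
    have h1 : F.card ≤ n.choose k := by
      have h := card_filter_le ((univ : Finset (Fin n)).powersetCard k) (fun e => e ∉ S)
      rwa [card_powersetCard, card_univ, Fintype.card_fin] at h
    exact_mod_cast h1.trans (Nat.choose_le_pow n k)
  obtain ⟨a, ha⟩ := exists_tuple_covering
    (fun (χ : Fin n → Fin m) (e : Finset (Fin n)) => e ⊆ isolatedZeros S χ) F
    (2 * (m : ℝ) ^ k) (by linarith) t
    (by
      intro e he
      simp only [hF, mem_filter, mem_powersetCard_univ] at he
      have h := hS.card_subset_isolatedZeros hk hm hmn he.1 he.2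
      rw [Fintype.card_fun, Fintype.card_fin, Fintype.card_fin]
      exact_mod_cast h)
    (lt_of_le_of_lt (by gcongr) ht)
  refine Nat.sInf_le ⟨fun j => isolatedZeros S (a j),
    fun j => isIndep_isolatedZeros (by omega) hS.1 _, fun e he heS => ha e ?_⟩
  simp [hF, he, heS]

/-- For every `k ≥ 3` there is a positive constant `c₂` depending only on `k` such that every
partial Steiner `(n,k,2)`-system `S` satisfies `ϑ(S) ≤ c₂ n^{k/(k-1)} log n`. -/
theorem partial_steiner_upper (k : ℕ) (hk : 3 ≤ k) :
    ∃ c₂ : ℝ, 0 < c₂ ∧ ∀ n : ℕ, ∀ S : Finset (Finset (Fin n)), IsPartialSteiner k S →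
      (vartheta k S : ℝ) ≤ c₂ * (n : ℝ) ^ ((k : ℝ) / ((k : ℝ) - 1)) * Real.log n := by
  set c : ℝ := 2 * (8 * (k : ℝ) ^ 2) ^ k * k + 1 with hc
  refine ⟨c, by positivity, fun n S hS => ?_⟩
  rcases Nat.lt_or_ge n 3 with hn | hn
  · have h0 : vartheta k S = 0 := by
      refine Nat.sInf_eq_zero.2 (Or.inl ⟨fun j => j.elim0, fun j => j.elim0, fun e he _ => ?_⟩)
      have := card_le_univ e
      rw [Fintype.card_fin] at this
      omega
    rw [h0, Nat.cast_zero]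
    have := Real.log_natCast_nonneg n
    positivity
  have hk1 : (0 : ℝ) < (k : ℝ) - 1 := by
    have : (3 : ℝ) ≤ k := by exact_mod_cast hk
    linarith
  have hn1 : (1 : ℝ) ≤ n := by exact_mod_cast (by omega : 1 ≤ n)
  set x : ℝ := (n : ℝ) ^ (1 / ((k : ℝ) - 1)) with hx
  have hx1 : 1 ≤ x := Real.one_le_rpow hn1 (by positivity)
  have hxk : x ^ (k - 1) = n := by
    rw [hx, ← Real.rpow_mul_natCast (by positivity), Nat.cast_sub (by omega), Nat.cast_one,
      one_div_mul_cancel hk1.ne', Real.rpow_one]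
  have hxk' : x ^ k = (n : ℝ) ^ ((k : ℝ) / ((k : ℝ) - 1)) := by
    rw [hx, ← Real.rpow_mul_natCast (by positivity)]
    congr 1
    ring
  have hlog : 1 ≤ Real.log n := by
    rw [Real.le_log_iff_exp_le (by positivity)]
    have : (3 : ℝ) ≤ n := by exact_mod_cast hn
    linarith [Real.exp_one_lt_three]
  set m : ℕ := 4 * k ^ 2 * ⌈x⌉₊ with hm
  have hceil : 0 < ⌈x⌉₊ := Nat.ceil_pos.2 (by linarith)
  have hm0 : 0 < m := by positivity
  have : NeZero m := ⟨hm0.ne'⟩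
  have hmle : 4 * k ^ 2 ≤ m := Nat.le_mul_of_pos_right _ hceil
  have hmn : 4 * k * n ≤ m ^ (k - 1) := by
    have h1 : n ≤ ⌈x⌉₊ ^ (k - 1) := by
      have : (n : ℝ) ≤ (⌈x⌉₊ : ℝ) ^ (k - 1) := by
        rw [← hxk]
        gcongr
        exact Nat.le_ceil x
      exact_mod_cast this
    have h2 : 4 * k ≤ (4 * k ^ 2) ^ (k - 1) :=
      calc 4 * k ≤ 4 * k ^ 2 := by gcongr; exact Nat.le_self_pow two_ne_zero k
        _ ≤ (4 * k ^ 2) ^ (k - 1) := Nat.le_self_pow (by omega) _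
    rw [hm, mul_pow]
    exact Nat.mul_le_mul h2 h1
  have hmk : (m : ℝ) ^ k ≤ (8 * (k : ℝ) ^ 2) ^ k * x ^ k := by
    rw [← mul_pow]
    have h1 : (⌈x⌉₊ : ℝ) ≤ 2 * x := by
      have := Nat.ceil_lt_add_one (a := x) (by linarith)
      linarith
    have h2 : (m : ℝ) = 4 * (k : ℝ) ^ 2 * ⌈x⌉₊ := by rw [hm]; push_cast; ring
    gcongr
    calc (m : ℝ) = 4 * (k : ℝ) ^ 2 * ⌈x⌉₊ := h2
      _ ≤ 4 * (k : ℝ) ^ 2 * (2 * x) := by gcongr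
      _ = 8 * (k : ℝ) ^ 2 * x := by ring
  have hQ : (0 : ℝ) < 2 * (m : ℝ) ^ k := by positivity
  set y : ℝ := 2 * (m : ℝ) ^ k * (k * Real.log n) with hy
  have hy0 : 0 ≤ y := by positivity
  have hcover : (n : ℝ) ^ k * Real.exp (-(((⌊y⌋₊ + 1 : ℕ) : ℝ) / (2 * (m : ℝ) ^ k))) < 1 := by
    have h1 : (k : ℝ) * Real.log n < ((⌊y⌋₊ + 1 : ℕ) : ℝ) / (2 * (m : ℝ) ^ k) := by
      rw [lt_div_iff₀ hQ, mul_comm]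
      push_cast
      exact Nat.lt_floor_add_one y
    have h2 : (n : ℝ) ^ k = Real.exp (k * Real.log n) := by
      rw [Real.exp_nat_mul, Real.exp_log (by positivity)]
    rw [h2, ← Real.exp_add, Real.exp_lt_one_iff]
    linarith
  have hv : (vartheta k S : ℝ) ≤ ((⌊y⌋₊ + 1 : ℕ) : ℝ) := by
    exact_mod_cast hS.vartheta_le (by omega) hmle hmn hcover
  have hxk1 : 1 ≤ x ^ k := one_le_pow₀ hx1
  rw [← hxk']
  calc (vartheta k S : ℝ) ≤ y + 1 := by
        refine hv.trans ?_
        push_cast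
        gcongr
        exact Nat.floor_le hy0
    _ ≤ 2 * ((8 * (k : ℝ) ^ 2) ^ k * x ^ k) * (k * Real.log n) + x ^ k * Real.log n := by
        rw [hy]
        have := one_le_mul_of_one_le_of_one_le hxk1 hlog
        gcongr
    _ = c * x ^ k * Real.log n := by rw [hc]; ring
end
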